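/- Assume hypothesis (****) with d = 2 and with X = ℝ² or X = H², that both K and L have supporting circles at all of their boundary points, and that condition (6) of Theorem 8 holds: whenever φ, ψ and x ∈ bd K, y ∈ bd L satisfy (A) the diameter of conv((φK) ∪ (ψL)) is sufficiently large and (B) conv((φK) ∪ (ψL)) has D := [φx, ψy] as its unique diametral segment, there exists ε(K,L,x,y,φ,ψ) > 0 such that for all 0 < ε below this bound, the set conv((φK) ∪ (ψL)) ∩ D(ε) admits some non-trivial congruence. Then K and L are C¹ (have smooth boundaries). -/

import Mathlib

open Metric Set Filter

namespace BallChar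

/-- `X` is (isometric to) the `d`-dimensional round sphere of radius 1,
with the intrinsic (great-circle) metric. -/
def IsSphereSpace (X : Type*) [MetricSpace X] (d : ℕ) : Prop :=
  ∃ e : X → EuclideanSpace ℝ (Fin (d + 1)),
    Function.Injective e ∧
    Set.range e = Metric.sphere (0 : EuclideanSpace ℝ (Fin (d + 1))) 1 ∧
    ∀ x y : X, dist x y = Real.arccos (@inner ℝ _ _ (e x) (e y))

/-- `X` is (isometric to) the `d`-dimensional Euclidean space. -/
def IsEuclideanSpaceForm (X : Type*) [MetricSpace X] (d : ℕ) : Prop :=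
  Nonempty (X ≃ᵢ EuclideanSpace ℝ (Fin d))

/-- The Minkowski bilinear form on `ℝ^d × ℝ`. -/
noncomputable def mink (d : ℕ) (u v : EuclideanSpace ℝ (Fin d) × ℝ) : ℝ :=
  @inner ℝ _ _ u.1 v.1 - u.2 * v.2

/-- `X` is (isometric to) the `d`-dimensional hyperbolic space of curvature `-1`
(the hyperboloid model). -/
def IsHyperbolicSpace (X : Type*) [MetricSpace X] (d : ℕ) : Prop :=
  ∃ e : X → EuclideanSpace ℝ (Fin d) × ℝ,
    Function.Injective e ∧
    Set.range e = {u | mink d u u = -1 ∧ 0 < u.2} ∧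
    ∀ x y : X, Real.cosh (dist x y) = - mink d (e x) (e y)

/-- `X` is `S^d`, `ℝ^d` or `H^d`. -/
def IsSpaceForm (X : Type*) [MetricSpace X] (d : ℕ) : Prop :=
  IsSphereSpace X d ∨ IsEuclideanSpaceForm X d ∨ IsHyperbolicSpace X d

variable {X : Type*} [MetricSpace X]

/-- Metric betweenness: `z` lies on a shortest geodesic from `x` to `y`. -/
def Btw (x z y : X) : Prop := dist x z + dist z y = dist x y

/-- `z` is the unique point between `x` and `y` at its distance from `x`. -/
def UniqueBtwPt (x z y : X) : Prop :=
  Btw x z y ∧ ∀ w, Btw x w y → dist x w = dist x z → w = z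

/-- Geodesic convexity (for two antipodal points of a sphere no condition is imposed). -/
def GConvex (K : Set X) : Prop :=
  ∀ x ∈ K, ∀ y ∈ K, ∀ z, UniqueBtwPt x z y → z ∈ K

/-- `p` is a (metric) midpoint of `x` and `y`. -/
def IsMidpoint (p x y : X) : Prop := Btw x p y ∧ dist x p = dist p y

/-- A reflection in a hyperplane: a non-trivial involutive isometry whose
non-fixed locus is disconnected (by the mirror hyperplane). -/
def IsReflection (σ : X ≃ᵢ X) : Prop :=
  σ.trans σ = IsometryEquiv.refl X ∧ σ ≠ IsometryEquiv.refl X ∧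
    ¬ IsPreconnected {x : X | σ x ≠ x}

/-- An orientation preserving congruence: a product of an even number of reflections. -/
def OrientationPreserving (f : X ≃ᵢ X) : Prop :=
  ∃ l : List (X ≃ᵢ X), (∀ σ ∈ l, IsReflection σ) ∧ Even l.length ∧
    f = l.foldr IsometryEquiv.trans (IsometryEquiv.refl X)

/-- Two subsets are congruent if some isometry of the space maps one onto the other. -/
def Congruent (A B : Set X) : Prop := ∃ f : X ≃ᵢ X, ⇑f '' A = B

/-- `S` admits some non-trivial congruence. -/
def AdmitsNontrivialCongruence (S : Set X) : Prop :=
  ∃ f : X ≃ᵢ X, f ≠ IsometryEquiv.refl X ∧ ⇑f '' S = S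

/-- `S` is axially symmetric (symmetric with respect to some reflection). -/
def AxiallySymmetric (S : Set X) : Prop :=
  ∃ σ : X ≃ᵢ X, IsReflection σ ∧ ⇑σ '' S = S

/-- `S` is centrally symmetric: some involutive isometry fixing a point `p`
maps `S` onto itself, `p` being a midpoint of every pair `x`, `σ x` of `S`. -/
def CentrallySymmetric (S : Set X) : Prop :=
  ∃ (σ : X ≃ᵢ X) (p : X), Function.Involutive ⇑σ ∧ σ p = p ∧ ⇑σ '' S = S ∧
    ∀ x ∈ S, IsMidpoint p x (σ x)

/-- `S` is symmetric with respect to the orthogonal bisector hyperplane of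
the segment `[a, b]`, i.e. invariant under the reflection interchanging `a` and `b`. -/
def SymmetricWrtPerpBisector (S : Set X) (a b : X) : Prop :=
  ∃ σ : X ≃ᵢ X, IsReflection σ ∧ σ a = b ∧ ⇑σ '' S = S

/-- A closed half-space: one of the two closed sides of the mirror of a reflection. -/
def IsHalfspace (P : Set X) : Prop :=
  ∃ σ : X ≃ᵢ X, IsReflection σ ∧ IsClosed P ∧
    P ∪ ⇑σ '' P = univ ∧ P ∩ ⇑σ '' P = {x | σ x = x}

/-- A hyperplane: the mirror (fixed point set) of a reflection. -/
def IsHyperplane (B : Set X) : Prop :=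
  ∃ σ : X ≃ᵢ X, IsReflection σ ∧ B = {x | σ x = x}

/-- A paraball (horoball): a sublevel set of a Busemann function. -/
def IsParaball (K : Set X) : Prop :=
  ∃ γ : ℝ → X, Isometry γ ∧
    K = {x | ∃ b ≤ 0, Tendsto (fun t => dist x (γ t) - t) atTop (nhds b)}

/-- A parasphere (horosphere): the boundary of a paraball. -/
def IsParasphere (C : Set X) : Prop := ∃ K : Set X, IsParaball K ∧ C = frontier K

/-- A hypersphere at distance `lam > 0` from its base hyperplane
(degeneration to a hyperplane excluded). -/
def IsHypersphere (C : Set X) (lam : ℝ) : Prop :=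
  0 < lam ∧ (∃ P : Set X, IsHalfspace P ∧ C = frontier {x | infDist x P ≤ lam}) ∧
    ¬ IsHyperplane C

/-- The family of connected components of the boundary of `K`. -/
def bdryComponents (K : Set X) : Set (Set X) :=
  (connectedComponentIn (frontier K)) '' (frontier K)

/-- `closedBall p r` is an inball of `M` (a ball of maximal radius contained in `M`). -/
def IsInball (M : Set X) (p : X) (r : ℝ) : Prop :=
  0 ≤ r ∧ closedBall p r ⊆ M ∧ ∀ (q : X) (s : ℝ), closedBall q s ⊆ M → s ≤ r

/-- `closedBall p r` is the unique inball of `M`. -/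
def HasUniqueInball (M : Set X) (p : X) (r : ℝ) : Prop :=
  IsInball M p r ∧ ∀ (q : X) (s : ℝ), IsInball M q s → q = p

/-- The (geodesic) convex hull of a set. -/
def gconvexHull (Y : Set X) : Set X := ⋂₀ {C : Set X | GConvex C ∧ Y ⊆ C}

/-- `z` lies on the complete geodesic line through `a` and `b`. -/
def OnLine (a b z : X) : Prop := Btw a z b ∨ Btw z a b ∨ Btw a b z

/-- The closed `(d-1)`-ball of radius `ε` centred at `a` in the hyperplane through `a`
orthogonal to the segment `[a, b]`. -/
def perpDisc (a b : X) (ε : ℝ) : Set X :=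
  {x | (∀ z, OnLine a b z → dist x a ≤ dist x z) ∧ dist x a ≤ ε}

/-- The set `D(ε)` associated to the segment `D = [a, b]`: the convex hull of the two
`(d-1)`-balls of radius `ε` orthogonal to `D` at its endpoints. -/
def segCyl (a b : X) (ε : ℝ) : Set X :=
  gconvexHull (perpDisc a b ε ∪ perpDisc b a ε)

/-- `[a, b]` is the unique diametral segment of `M`. -/
def UniqueDiametral (M : Set X) (a b : X) : Prop :=
  a ∈ M ∧ b ∈ M ∧ a ≠ b ∧ dist a b = diam M ∧
    ∀ a' ∈ M, ∀ b' ∈ M, dist a' b' = diam M → (a' = a ∧ b' = b) ∨ (a' = b ∧ b' = a)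

/-- Condition (**): at every boundary point, `K` contains a ball having this point
on its boundary. -/
def CondBallInside (K : Set X) : Prop :=
  ∀ x ∈ frontier K, ∃ ε > 0, ∃ p : X, closedBall p ε ⊆ K ∧ x ∈ sphere p ε

/-- `K` has an extreme point. -/
def HasExtremePoint (K : Set X) : Prop :=
  ∃ x ∈ K, ∀ y ∈ K, ∀ z ∈ K, Btw y x z → x = y ∨ x = z

/-- Condition (***): near every boundary point, `K` is contained in a ball
(resp. in a convex set bounded by a hypersphere, for hyperbolic space) whose boundary
has sectional curvatures bounded below and passes through the given point. -/
def CondCurvBound (d : ℕ) (K : Set X) : Prop :=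
  ∀ x ∈ frontier K, ∃ ε > 0, ∃ B : Set X,
    {y | y ∈ K ∧ dist y x ≤ ε} ⊆ B ∧ x ∈ frontier B ∧
    (IsSphereSpace X d → ∃ (q : X) (R : ℝ), 0 < R ∧ R < Real.pi / 2 ∧
        ε ≤ Real.cos R / Real.sin R ∧ B = closedBall q R) ∧
    (IsEuclideanSpaceForm X d → ∃ (q : X) (R : ℝ), 0 < R ∧ ε ≤ 1 / R ∧ B = closedBall q R) ∧
    (IsHyperbolicSpace X d → ∃ (P : Set X) (lam : ℝ), IsHalfspace P ∧ 0 < lam ∧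
        ε ≤ Real.tanh lam ∧ B = {y | infDist y P ≤ lam})

/-- `K` has a supporting sphere at each of its boundary points
(for the sphere, of radius less than `π/2`). -/
def SupportingSpheres (d : ℕ) (K : Set X) : Prop :=
  ∀ x ∈ frontier K, ∃ (p : X) (R : ℝ), 0 < R ∧ K ⊆ closedBall p R ∧ x ∈ sphere p R ∧
    (IsSphereSpace X d → R < Real.pi / 2)

/-- `K` is `C¹` (smooth): at each boundary point there is a unique supporting half-space. -/
def SmoothBody (K : Set X) : Prop :=
  ∀ x ∈ frontier K, ∃! P : Set X, IsHalfspace P ∧ K ⊆ P ∧ x ∈ frontier P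

/-- A complete geodesic (straight line). -/
def IsGeodesicLine (B : Set X) : Prop := ∃ γ : ℝ → X, Isometry γ ∧ B = Set.range γ

/-- A circle (closed disc) of positive radius. -/
def IsDisc (K : Set X) : Prop := ∃ (p : X) (r : ℝ), 0 < r ∧ K = closedBall p r

/-- The parallel domain of `B` at distance `l`. -/
def parallelDomain (B : Set X) (l : ℝ) : Set X := {x | infDist x B ≤ l}

/-- `K` is the parallel domain of some straight line, at some distance `l > 0`. -/
def IsParallelDomain (K : Set X) : Prop :=
  ∃ (B : Set X) (l : ℝ), IsGeodesicLine B ∧ 0 < l ∧ K = parallelDomain B l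

/-- A convex domain bounded by a (proper) hypercycle. -/
def IsHypercycleDomain (K : Set X) : Prop :=
  ∃ (P : Set X) (l : ℝ), IsHalfspace P ∧ 0 < l ∧ K = {x | infDist x P ≤ l}

/-- `C` is a hypercycle or a straight line (a curve at constant distance `l ≥ 0`
from its base line). -/
def IsHypercycleOrLine (C : Set X) : Prop :=
  ∃ (P : Set X) (l : ℝ), IsHalfspace P ∧ 0 ≤ l ∧ C = frontier {x | infDist x P ≤ l}

/-- `C` is a hypercycle (or straight line) with base line `B`. -/
def HypercycleWithBase (C B : Set X) : Prop :=
  ∃ (P : Set X) (l : ℝ), IsHalfspace P ∧ 0 ≤ l ∧ frontier P = B ∧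
    C = frontier {x | infDist x P ≤ l}


/-! Cases (A)-(E) of Theorem 5 (hyperbolic plane). -/

/-- One of the basic bodies of case (A). -/
def CaseABody (K : Set X) : Prop :=
  IsDisc K ∨ IsParaball K ∨ IsHypercycleDomain K ∨ IsHalfspace K

/-- Case (A) of Theorem 5. -/
def CaseA (K L : Set X) : Prop :=
  CaseABody K ∧ CaseABody L ∧
    ((IsHypercycleDomain K ∨ IsHalfspace K) → IsDisc L ∨ Congruent K L) ∧
    ((IsHypercycleDomain L ∨ IsHalfspace L) → IsDisc K ∨ Congruent L K)

/-- `M` is bounded either by two hypercycles whose base lines coincide, or by a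
hypercycle and its base line. -/
def TwoHypSameBase (M : Set X) : Prop :=
  ∃ (B C₁ C₂ : Set X), IsGeodesicLine B ∧ C₁ ≠ C₂ ∧
    HypercycleWithBase C₁ B ∧ HypercycleWithBase C₂ B ∧ frontier M = C₁ ∪ C₂

/-- Case (B) of Theorem 5. -/
def CaseB (K L : Set X) : Prop :=
  (IsDisc K ∧ TwoHypSameBase L) ∨ (IsDisc L ∧ TwoHypSameBase K)

/-- `M` is bounded by at least two hypercycles or straight lines, with all base lines
different, whose mutual distances are at least `2r`. -/
def MultiHypFarApart (M : Set X) (r : ℝ) : Prop :=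
  (∀ x ∈ frontier M, IsHypercycleOrLine (connectedComponentIn (frontier M) x)) ∧
  (∃ x ∈ frontier M, ∃ y ∈ frontier M,
      connectedComponentIn (frontier M) x ≠ connectedComponentIn (frontier M) y) ∧
  (∀ x ∈ frontier M, ∀ y ∈ frontier M,
      connectedComponentIn (frontier M) x ≠ connectedComponentIn (frontier M) y →
        2 * r ≤ dist x y ∧
        ∀ B₁ B₂ : Set X, HypercycleWithBase (connectedComponentIn (frontier M) x) B₁ →
          HypercycleWithBase (connectedComponentIn (frontier M) y) B₂ → B₁ ≠ B₂)

/-- Case (C) of Theorem 5. -/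
def CaseC (K L : Set X) : Prop :=
  (∃ (p : X) (r : ℝ), 0 < r ∧ K = closedBall p r ∧ MultiHypFarApart L r) ∨
  (∃ (p : X) (r : ℝ), 0 < r ∧ L = closedBall p r ∧ MultiHypFarApart K r)

/-- Case (D) of Theorem 5. -/
def CaseD (K L : Set X) : Prop :=
  (IsParaball K ∧ IsParallelDomain L) ∨ (IsParaball L ∧ IsParallelDomain K)

/-- Case (E) of Theorem 5. -/
def CaseE (K L : Set X) : Prop :=
  Congruent K L ∧ IsParallelDomain K ∧ IsParallelDomain L

/-- All cases of (3) of Theorem 5 together. -/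
def Theorem5Cases (K L : Set X) : Prop :=
  CaseA K L ∨ CaseB K L ∨ CaseC K L ∨ CaseD K L ∨ CaseE K L

/-- Condition (1) of Theorem 5: every intersection of congruent copies admits some
non-trivial congruence. -/
def T5Cond1 (K L : Set X) : Prop :=
  ∀ φ ψ : X ≃ᵢ X, OrientationPreserving φ → OrientationPreserving ψ →
    (interior ((⇑φ '' K) ∩ (⇑ψ '' L))).Nonempty →
    AdmitsNontrivialCongruence ((⇑φ '' K) ∩ (⇑ψ '' L))

/-- Condition (2) of Theorem 5: every intersection of congruent copies is axially
symmetric. -/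
def T5Cond2 (K L : Set X) : Prop :=
  ∀ φ ψ : X ≃ᵢ X, OrientationPreserving φ → OrientationPreserving ψ →
    (interior ((⇑φ '' K) ∩ (⇑ψ '' L))).Nonempty →
    AxiallySymmetric ((⇑φ '' K) ∩ (⇑ψ '' L))

/-- All connected components of the boundary of `K` are hypercycles or straight lines. -/
def BdryHypOrLine (K : Set X) : Prop :=
  ∀ x ∈ frontier K, IsHypercycleOrLine (connectedComponentIn (frontier K) x)

/-- The boundary of `K` has at least two connected components. -/
def AtLeastTwoComponents (K : Set X) : Prop :=
  ∃ x ∈ frontier K, ∃ y ∈ frontier K,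
    connectedComponentIn (frontier K) x ≠ connectedComponentIn (frontier K) y

/-- The boundary of `K` is nonempty and has a single connected component. -/
def SingleComponent (K : Set X) : Prop :=
  (frontier K).Nonempty ∧ ∀ x ∈ frontier K, ∀ y ∈ frontier K,
    connectedComponentIn (frontier K) x = connectedComponentIn (frontier K) y

/-- The associated graph of `K` contains two edges with at least one common endpoint:
`K` has two distinct boundary components which are asymptotic (come arbitrarily close). -/
def TwoAsymptoticComponents (K : Set X) : Prop :=
  ∃ x ∈ frontier K, ∃ y ∈ frontier K,
    connectedComponentIn (frontier K) x ≠ connectedComponentIn (frontier K) y ∧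
    ∀ δ > (0 : ℝ), ∃ p ∈ connectedComponentIn (frontier K) x,
      ∃ q ∈ connectedComponentIn (frontier K) y, dist p q < δ

/-- The associated graph of `K` has only pairwise vertex-disjoint edges: distinct
boundary components of `K` stay at positive distance from each other. -/
def VertexDisjointEdges (K : Set X) : Prop :=
  ∀ x ∈ frontier K, ∀ y ∈ frontier K,
    connectedComponentIn (frontier K) x ≠ connectedComponentIn (frontier K) y →
      ∃ δ > (0 : ℝ), ∀ p ∈ connectedComponentIn (frontier K) x,
        ∀ q ∈ connectedComponentIn (frontier K) y, δ ≤ dist p q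

/-! Conditions of Theorem 6. -/

/-- Condition (1) of Theorem 6. -/
def T6Cond1 (K L : Set X) : Prop :=
  ∃ ε > (0 : ℝ), ∀ φ ψ : X ≃ᵢ X, OrientationPreserving φ → OrientationPreserving ψ →
    (interior ((⇑φ '' K) ∩ (⇑ψ '' L))).Nonempty →
    diam ((⇑φ '' K) ∩ (⇑ψ '' L)) < ε →
    CentrallySymmetric ((⇑φ '' K) ∩ (⇑ψ '' L))

/-- Condition (2) of Theorem 6. -/
def T6Cond2 (K L : Set X) : Prop :=
  ∀ x ∈ frontier K, ∀ y ∈ frontier L, ∃ ε > (0 : ℝ),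
    ∀ φ ψ : X ≃ᵢ X, OrientationPreserving φ → OrientationPreserving ψ →
      (interior ((⇑φ '' K) ∩ (⇑ψ '' L))).Nonempty →
      diam ((⇑φ '' K) ∩ (⇑ψ '' L)) < ε →
      ∀ (p : X) (r : ℝ), HasUniqueInball ((⇑φ '' K) ∩ (⇑ψ '' L)) p r →
        frontier ((⇑φ '' K) ∩ (⇑ψ '' L)) ∩ sphere p r = {φ x, ψ y} →
        φ x ∈ interior (⇑ψ '' L) → ψ y ∈ interior (⇑φ '' K) →
        IsMidpoint p (φ x) (ψ y) →
        CentrallySymmetric ((⇑φ '' K) ∩ (⇑ψ '' L))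

/-- Condition (3) of Theorem 6. -/
def T6Cond3 (K L : Set X) : Prop :=
  ∀ x ∈ frontier K, ∀ y ∈ frontier L, ∃ ε > (0 : ℝ),
    ∀ φ ψ : X ≃ᵢ X, OrientationPreserving φ → OrientationPreserving ψ →
      (interior ((⇑φ '' K) ∩ (⇑ψ '' L))).Nonempty →
      diam ((⇑φ '' K) ∩ (⇑ψ '' L)) < ε →
      ∀ (p : X) (r : ℝ), HasUniqueInball ((⇑φ '' K) ∩ (⇑ψ '' L)) p r →
        frontier ((⇑φ '' K) ∩ (⇑ψ '' L)) ∩ sphere p r = {φ x, ψ y} →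
        φ x ∈ interior (⇑ψ '' L) → ψ y ∈ interior (⇑φ '' K) →
        IsMidpoint p (φ x) (ψ y) →
        SymmetricWrtPerpBisector ((⇑φ '' K) ∩ (⇑ψ '' L)) (φ x) (ψ y)

/-- Condition (4) of Theorem 6. -/
def T6Cond4 (d : ℕ) (K L : Set X) : Prop :=
  (∃ r > (0 : ℝ), (IsSphereSpace X d → r ≤ Real.pi / 2) ∧
      (∀ C ∈ bdryComponents K ∪ bdryComponents L, ∃ p : X, C = sphere p r) ∧
      (∃ p : X, K = closedBall p r) ∧ ∃ q : X, L = closedBall q r) ∨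
  ((∀ C ∈ bdryComponents K ∪ bdryComponents L, IsParasphere C) ∧
      IsParaball K ∧ IsParaball L) ∨
  (∃ lam > (0 : ℝ), ∀ C ∈ bdryComponents K ∪ bdryComponents L, IsHypersphere C lam)

/-! Conditions of Theorems 7 and 8. -/

/-- The pair `φ, ψ` is admissible for hypothesis (****): both are orientation
preserving, and for the sphere `(φ K) ∪ (ψ L)` lies in an open hemisphere. -/
def GoodPair (d : ℕ) (K L : Set X) (φ ψ : X ≃ᵢ X) : Prop :=
  OrientationPreserving φ ∧ OrientationPreserving ψ ∧
    (IsSphereSpace X d → ∃ s : X, (⇑φ '' K) ∪ (⇑ψ '' L) ⊆ ball s (Real.pi / 2))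

/-- The convex hull of the union of the two congruent copies. -/
def hullUnion (K L : Set X) (φ ψ : X ≃ᵢ X) : Set X := gconvexHull ((⇑φ '' K) ∪ (⇑ψ '' L))

/-- Condition (A) of (3) of Theorem 7: the diameter of `M` is sufficiently close to `π`
(sphere), resp. sufficiently large (Euclidean, hyperbolic), as measured by `δ`. -/
def BigDiam (d : ℕ) (X : Type*) [MetricSpace X] (M : Set X) (δ : ℝ) : Prop :=
  (IsSphereSpace X d → Real.pi - δ < diam M) ∧ (¬ IsSphereSpace X d → 1 / δ < diam M)

/-- Condition (1) of Theorem 7. -/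
def T7Cond1 (d : ℕ) (K L : Set X) : Prop :=
  ∀ φ ψ : X ≃ᵢ X, GoodPair d K L φ ψ → CentrallySymmetric (hullUnion K L φ ψ)

/-- Condition (2) of Theorem 7. -/
def T7Cond2 (d : ℕ) (K L : Set X) : Prop :=
  ∀ φ ψ : X ≃ᵢ X, GoodPair d K L φ ψ → ∀ a b : X, UniqueDiametral (hullUnion K L φ ψ) a b →
    SymmetricWrtPerpBisector (hullUnion K L φ ψ) a b

/-- Condition (3) of Theorem 7. -/
def T7Cond3 (d : ℕ) (K L : Set X) : Prop :=
  ∃ δ > (0 : ℝ), ∀ φ ψ : X ≃ᵢ X, GoodPair d K L φ ψ →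
    ∀ x ∈ frontier K, ∀ y ∈ frontier L,
      BigDiam d X (hullUnion K L φ ψ) δ →
      UniqueDiametral (hullUnion K L φ ψ) (φ x) (ψ y) →
      CentrallySymmetric (hullUnion K L φ ψ)

/-- Condition (4) of Theorem 7. -/
def T7Cond4 (d : ℕ) (K L : Set X) : Prop :=
  ∃ δ > (0 : ℝ), ∀ φ ψ : X ≃ᵢ X, GoodPair d K L φ ψ →
    ∀ x ∈ frontier K, ∀ y ∈ frontier L,
      BigDiam d X (hullUnion K L φ ψ) δ →
      UniqueDiametral (hullUnion K L φ ψ) (φ x) (ψ y) →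
      SymmetricWrtPerpBisector (hullUnion K L φ ψ) (φ x) (ψ y)

/-- Condition (5) of Theorem 7. -/
def T7Cond5 (d : ℕ) (K L : Set X) : Prop :=
  ∃ δ > (0 : ℝ), ∀ φ ψ : X ≃ᵢ X, GoodPair d K L φ ψ →
    ∀ x ∈ frontier K, ∀ y ∈ frontier L,
      BigDiam d X (hullUnion K L φ ψ) δ →
      UniqueDiametral (hullUnion K L φ ψ) (φ x) (ψ y) →
      ∃ ε₀ > (0 : ℝ), ∀ ε : ℝ, 0 < ε → ε < ε₀ →
        (IsSphereSpace X d → ∃ s : X, (⇑φ '' K) ∪ (⇑ψ '' L) ⊆ ball s (Real.pi / 2) ∧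
            segCyl (φ x) (ψ y) ε ⊆ ball s (Real.pi / 2)) ∧
        CentrallySymmetric (hullUnion K L φ ψ ∩ segCyl (φ x) (ψ y) ε)

/-- Condition (6) of Theorem 7. -/
def T7Cond6 (d : ℕ) (K L : Set X) : Prop :=
  ∃ δ > (0 : ℝ), ∀ φ ψ : X ≃ᵢ X, GoodPair d K L φ ψ →
    ∀ x ∈ frontier K, ∀ y ∈ frontier L,
      BigDiam d X (hullUnion K L φ ψ) δ →
      UniqueDiametral (hullUnion K L φ ψ) (φ x) (ψ y) →
      ∃ ε₀ > (0 : ℝ), ∀ ε : ℝ, 0 < ε → ε < ε₀ →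
        (IsSphereSpace X d → ∃ s : X, (⇑φ '' K) ∪ (⇑ψ '' L) ⊆ ball s (Real.pi / 2) ∧
            segCyl (φ x) (ψ y) ε ⊆ ball s (Real.pi / 2)) ∧
        SymmetricWrtPerpBisector (hullUnion K L φ ψ ∩ segCyl (φ x) (ψ y) ε) (φ x) (ψ y)

/-- Condition (7) of Theorem 7: `K` and `L` are congruent balls. -/
def T7Cond7 (d : ℕ) (K L : Set X) : Prop :=
  ∃ r > (0 : ℝ), (IsSphereSpace X d → r < Real.pi / 2) ∧
    (∃ p : X, K = closedBall p r) ∧ ∃ q : X, L = closedBall q r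

/-- Condition (1) of Theorem 8. -/
def T8Cond1 (K L : Set X) : Prop :=
  ∀ φ ψ : X ≃ᵢ X, GoodPair 2 K L φ ψ → AxiallySymmetric (hullUnion K L φ ψ)

/-- Condition (2) of Theorem 8. -/
def T8Cond2 (K L : Set X) : Prop :=
  ∀ φ ψ : X ≃ᵢ X, GoodPair 2 K L φ ψ → AdmitsNontrivialCongruence (hullUnion K L φ ψ)

/-- Condition (3) of Theorem 8. -/
def T8Cond3 (K L : Set X) : Prop :=
  ∃ δ > (0 : ℝ), ∀ φ ψ : X ≃ᵢ X, GoodPair 2 K L φ ψ →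
    ∀ x ∈ frontier K, ∀ y ∈ frontier L,
      BigDiam 2 X (hullUnion K L φ ψ) δ →
      UniqueDiametral (hullUnion K L φ ψ) (φ x) (ψ y) →
      AxiallySymmetric (hullUnion K L φ ψ)

/-- Condition (4) of Theorem 8. -/
def T8Cond4 (K L : Set X) : Prop :=
  ∃ δ > (0 : ℝ), ∀ φ ψ : X ≃ᵢ X, GoodPair 2 K L φ ψ →
    ∀ x ∈ frontier K, ∀ y ∈ frontier L,
      BigDiam 2 X (hullUnion K L φ ψ) δ →
      UniqueDiametral (hullUnion K L φ ψ) (φ x) (ψ y) →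
      AdmitsNontrivialCongruence (hullUnion K L φ ψ)

/-- Condition (5) of Theorem 8. -/
def T8Cond5 (K L : Set X) : Prop :=
  ∃ δ > (0 : ℝ), ∀ φ ψ : X ≃ᵢ X, GoodPair 2 K L φ ψ →
    ∀ x ∈ frontier K, ∀ y ∈ frontier L,
      BigDiam 2 X (hullUnion K L φ ψ) δ →
      UniqueDiametral (hullUnion K L φ ψ) (φ x) (ψ y) →
      ∃ ε₀ > (0 : ℝ), ∀ ε : ℝ, 0 < ε → ε < ε₀ →
        (IsSphereSpace X 2 → ∃ s : X, (⇑φ '' K) ∪ (⇑ψ '' L) ⊆ ball s (Real.pi / 2) ∧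
            segCyl (φ x) (ψ y) ε ⊆ ball s (Real.pi / 2)) ∧
        AxiallySymmetric (hullUnion K L φ ψ ∩ segCyl (φ x) (ψ y) ε)

/-- Condition (6) of Theorem 8. -/
def T8Cond6 (K L : Set X) : Prop :=
  ∃ δ > (0 : ℝ), ∀ φ ψ : X ≃ᵢ X, GoodPair 2 K L φ ψ →
    ∀ x ∈ frontier K, ∀ y ∈ frontier L,
      BigDiam 2 X (hullUnion K L φ ψ) δ →
      UniqueDiametral (hullUnion K L φ ψ) (φ x) (ψ y) →
      ∃ ε₀ > (0 : ℝ), ∀ ε : ℝ, 0 < ε → ε < ε₀ →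
        (IsSphereSpace X 2 → ∃ s : X, (⇑φ '' K) ∪ (⇑ψ '' L) ⊆ ball s (Real.pi / 2) ∧
            segCyl (φ x) (ψ y) ε ⊆ ball s (Real.pi / 2)) ∧
        AdmitsNontrivialCongruence (hullUnion K L φ ψ ∩ segCyl (φ x) (ψ y) ε)

/-- Condition (7) of Theorem 8: `K` and `L` are (in general incongruent) circles. -/
def T8Cond7 (K L : Set X) : Prop :=
  ∃ (p q : X) (r s : ℝ), 0 < r ∧ 0 < s ∧
    (IsSphereSpace X 2 → r < Real.pi / 2 ∧ s < Real.pi / 2) ∧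
    K = closedBall p r ∧ L = closedBall q s


/-- The sine function of the plane of curvature `-k`, for `k = 0` or `k = 1`. -/
noncomputable def sn (k t : ℝ) : ℝ := if k = 0 then t else Real.sinh t

/-- The cosine function of the plane of curvature `-k`, for `k = 0` or `k = 1`. -/
noncomputable def cs (k t : ℝ) : ℝ := if k = 0 then 1 else Real.cosh t

/-- The squared chord length of two points at distance `t` in the plane of curvature `-k`. -/
noncomputable def chord (k t : ℝ) : ℝ := if k = 0 then t ^ 2 else 2 * Real.cosh t - 2

lemma sn_euclidean (t : ℝ) : sn 0 t = t := by simp [sn]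
lemma sn_hyperbolic (t : ℝ) : sn 1 t = Real.sinh t := by simp [sn]
lemma cs_euclidean (t : ℝ) : cs 0 t = 1 := by simp [cs]
lemma cs_hyperbolic (t : ℝ) : cs 1 t = Real.cosh t := by simp [cs]
lemma chord_euclidean (t : ℝ) : chord 0 t = t ^ 2 := by simp [chord]
lemma chord_hyperbolic (t : ℝ) : chord 1 t = 2 * Real.cosh t - 2 := by simp [chord]

lemma sn_zero (k : ℝ) : sn k 0 = 0 := by unfold sn; split_ifs <;> simp

lemma cs_zero (k : ℝ) : cs k 0 = 1 := by unfold cs; split_ifs <;> simp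

lemma sn_pos (k : ℝ) {t : ℝ} (ht : 0 < t) : 0 < sn k t := by
  unfold sn; split_ifs
  · exact ht
  · exact Real.sinh_pos_iff.2 ht

lemma sn_nonneg (k : ℝ) {t : ℝ} (ht : 0 ≤ t) : 0 ≤ sn k t := by
  rcases ht.eq_or_lt with rfl | ht
  · rw [sn_zero]
  · exact (sn_pos k ht).le

lemma cs_pos (k t : ℝ) : 0 < cs k t := by
  unfold cs; split_ifs
  · exact one_pos
  · exact Real.cosh_pos t

lemma cs_sq {k : ℝ} (hk : k = 0 ∨ k = 1) (t : ℝ) : cs k t ^ 2 = 1 + k * sn k t ^ 2 := by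
  rcases hk with rfl | rfl
  · simp [cs]
  · rw [cs_hyperbolic, sn_hyperbolic, Real.cosh_sq]; ring

lemma chord_zero (k : ℝ) : chord k 0 = 0 := by unfold chord; split_ifs <;> simp

lemma chord_abs (k t : ℝ) : chord k |t| = chord k t := by unfold chord; split_ifs <;> simp

lemma chord_le_chord (k : ℝ) {s t : ℝ} (hs : 0 ≤ s) (ht : 0 ≤ t) :
    chord k s ≤ chord k t ↔ s ≤ t := by
  unfold chord; split_ifs
  · exact sq_le_sq₀ hs ht
  · have := Real.cosh_le_cosh (x := s) (y := t)
    rw [abs_of_nonneg hs, abs_of_nonneg ht] at this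
    rw [← this]
    constructor <;> intro h <;> linarith

lemma chord_lt_chord (k : ℝ) {s t : ℝ} (hs : 0 ≤ s) (ht : 0 ≤ t) :
    chord k s < chord k t ↔ s < t := by
  rw [← not_le, chord_le_chord k ht hs, not_le]

lemma chord_inj (k : ℝ) {s t : ℝ} (hs : 0 ≤ s) (ht : 0 ≤ t) :
    chord k s = chord k t ↔ s = t := by
  rw [le_antisymm_iff, chord_le_chord k hs ht, chord_le_chord k ht hs, ← le_antisymm_iff]

lemma sq_le_chord (k t : ℝ) : t ^ 2 ≤ chord k t := by
  unfold chord; split_ifs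
  · exact le_rfl
  · have h1 : Real.cosh t = 1 + 2 * Real.sinh (t / 2) ^ 2 := by
      have := Real.cosh_two_mul (t / 2)
      rw [mul_div_cancel₀ _ two_ne_zero, Real.cosh_sq] at this
      linarith
    have h2 : (t / 2) ^ 2 ≤ Real.sinh (t / 2) ^ 2 := by
      rw [sq_le_sq]
      rcases le_total 0 (t / 2) with h | h
      · rw [abs_of_nonneg h, abs_of_nonneg (Real.sinh_nonneg_iff.2 h)]
        exact Real.self_le_sinh_iff.2 h
      · rw [abs_of_nonpos h, abs_of_nonpos (Real.sinh_nonpos_iff.2 h)]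
        have := Real.sinh_le_self_iff.2 h
        linarith
    nlinarith

lemma chord_continuous (k : ℝ) : Continuous (chord k) := by
  unfold chord
  split_ifs
  · fun_prop
  · exact (Real.continuous_cosh.const_mul 2).sub continuous_const

lemma chord_sub {k : ℝ} (hk : k = 0 ∨ k = 1) (s t : ℝ) :
    chord k (s - t) = (sn k s - sn k t) ^ 2 - k * (cs k s - cs k t) ^ 2 := by
  rcases hk with rfl | rfl
  · simp [sn, cs, chord]
  · rw [chord_hyperbolic, sn_hyperbolic, sn_hyperbolic, cs_hyperbolic, cs_hyperbolic,
      Real.cosh_sub]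
    nlinarith [Real.cosh_sq s, Real.cosh_sq t]

variable (X) in
/-- A coordinate system identifying `X` with the surface `w ^ 2 = 1 + k * (u ^ 2 + v ^ 2)`,
`0 < w`, which is a Euclidean plane for `k = 0` and a hyperbolic plane for `k = 1`. -/
structure PlaneModel (k : ℝ) where
  hk : k = 0 ∨ k = 1
  e₁ : X → ℝ
  e₂ : X → ℝ
  e₃ : X → ℝ
  pos : ∀ z, 0 < e₃ z
  surf : ∀ z, e₃ z ^ 2 = 1 + k * (e₁ z ^ 2 + e₂ z ^ 2)
  surj : ∀ u v w : ℝ, 0 < w → w ^ 2 = 1 + k * (u ^ 2 + v ^ 2) →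
    ∃ z, e₁ z = u ∧ e₂ z = v ∧ e₃ z = w
  chord_dist : ∀ a b, chord k (dist a b) =
    (e₁ a - e₁ b) ^ 2 + (e₂ a - e₂ b) ^ 2 - k * (e₃ a - e₃ b) ^ 2

lemma IsEuclideanSpaceForm.nonempty_planeModel (h : IsEuclideanSpaceForm X 2) :
    Nonempty (PlaneModel X 0) := by
  obtain ⟨i⟩ := h
  refine ⟨⟨Or.inl rfl, fun z => i z 0, fun z => i z 1, fun _ => 1, fun _ => one_pos,
    fun z => by simp, ?_, ?_⟩⟩
  · intro u v w hw h
    refine ⟨i.symm !₂[u, v], by simp, by simp, ?_⟩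
    simp only [zero_mul, add_zero] at h
    nlinarith
  · intro a b
    rw [chord_euclidean, ← i.dist_eq, EuclideanSpace.dist_eq, Real.sq_sqrt (by positivity)]
    simp [Fin.sum_univ_two, Real.dist_eq, sq_abs]

lemma IsHyperbolicSpace.nonempty_planeModel (h : IsHyperbolicSpace X 2) :
    Nonempty (PlaneModel X 1) := by
  obtain ⟨e, -, hr, hd⟩ := h
  have hmem : ∀ z, mink 2 (e z) (e z) = -1 ∧ 0 < (e z).2 := fun z => by
    have : e z ∈ Set.range e := ⟨z, rfl⟩
    rwa [hr] at this
  have hm : ∀ u v : EuclideanSpace ℝ (Fin 2) × ℝ,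
      mink 2 u v = u.1 0 * v.1 0 + u.1 1 * v.1 1 - u.2 * v.2 := fun u v => by
    simp [mink, PiLp.inner_apply, Fin.sum_univ_two, mul_comm]
  refine ⟨⟨Or.inr rfl, fun z => (e z).1 0, fun z => (e z).1 1, fun z => (e z).2,
    fun z => (hmem z).2, fun z => ?_, ?_, ?_⟩⟩
  · have := (hmem z).1
    rw [hm] at this
    linarith
  · intro u v w hw h
    have : ((!₂[u, v], w) : EuclideanSpace ℝ (Fin 2) × ℝ) ∈ Set.range e := by
      rw [hr]
      refine ⟨?_, hw⟩
      rw [hm]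
      simp
      linarith
    obtain ⟨z, hz⟩ := this
    exact ⟨z, by simp [hz], by simp [hz], by simp [hz]⟩
  · intro a b
    have h1 := (hmem a).1
    have h2 := (hmem b).1
    rw [hm] at h1 h2
    rw [chord_hyperbolic, hd, hm]
    linarith

namespace PlaneModel

variable {k : ℝ} (M : PlaneModel X k)

lemma ext_coord {a b : X} (h₁ : M.e₁ a = M.e₁ b) (h₂ : M.e₂ a = M.e₂ b)
    (h₃ : M.e₃ a = M.e₃ b) : a = b := by
  have := M.chord_dist a b
  rw [h₁, h₂, h₃, sub_self, sub_self, sub_self] at this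
  rw [← dist_eq_zero]
  refine (chord_inj k dist_nonneg le_rfl).1 ?_
  rw [this, chord_zero]; ring

lemma e₃_eq_of_sq_eq {a b : X} (h : M.e₁ a ^ 2 + M.e₂ a ^ 2 = M.e₁ b ^ 2 + M.e₂ b ^ 2) :
    M.e₃ a = M.e₃ b := by
  have := M.surf a
  rw [h, ← M.surf b] at this
  exact (sq_eq_sq₀ (M.pos a).le (M.pos b).le).1 this

lemma exists_coord (u v : ℝ) :
    ∃ z, M.e₁ z = u ∧ M.e₂ z = v ∧ M.e₃ z = √(1 + k * (u ^ 2 + v ^ 2)) := by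
  have hk : 0 ≤ k := by rcases M.hk with rfl | rfl <;> norm_num
  have : 0 < 1 + k * (u ^ 2 + v ^ 2) := by positivity
  exact M.surj u v _ (Real.sqrt_pos.2 this) (Real.sq_sqrt this.le)

/-- The point in the direction of a vector inside the future cone. -/
lemma exists_normalized {u v w : ℝ} (hw : 0 < w) (h : k * (u ^ 2 + v ^ 2) < w ^ 2) :
    ∃ z, ∃ c > 0, u = c * M.e₁ z ∧ v = c * M.e₂ z ∧ w = c * M.e₃ z := by
  set c := √(w ^ 2 - k * (u ^ 2 + v ^ 2)) with hc
  have hpos : 0 < c := Real.sqrt_pos.2 (by linarith)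
  have hsq : c ^ 2 = w ^ 2 - k * (u ^ 2 + v ^ 2) := Real.sq_sqrt (by linarith)
  obtain ⟨z, h₁, h₂, h₃⟩ := M.surj (u / c) (v / c) (w / c) (by positivity) (by
    field_simp
    linarith)
  exact ⟨z, c, hpos, by rw [h₁]; field_simp, by rw [h₂]; field_simp, by rw [h₃]; field_simp⟩

lemma dist_le_iff {a b : X} {r : ℝ} (hr : 0 ≤ r) : dist a b ≤ r ↔
    (M.e₁ a - M.e₁ b) ^ 2 + (M.e₂ a - M.e₂ b) ^ 2 - k * (M.e₃ a - M.e₃ b) ^ 2 ≤ chord k r := by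
  rw [← M.chord_dist, chord_le_chord k dist_nonneg hr]

lemma dist_lt_iff {a b : X} {r : ℝ} (hr : 0 ≤ r) : dist a b < r ↔
    (M.e₁ a - M.e₁ b) ^ 2 + (M.e₂ a - M.e₂ b) ^ 2 - k * (M.e₃ a - M.e₃ b) ^ 2 < chord k r := by
  rw [← M.chord_dist, chord_lt_chord k dist_nonneg hr]

lemma dist_eq_iff {a b : X} {r : ℝ} (hr : 0 ≤ r) : dist a b = r ↔
    (M.e₁ a - M.e₁ b) ^ 2 + (M.e₂ a - M.e₂ b) ^ 2 - k * (M.e₃ a - M.e₃ b) ^ 2 = chord k r := by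
  rw [← M.chord_dist, chord_inj k dist_nonneg hr]

lemma dist_le_dist_iff {a b c d : X} : dist a b ≤ dist c d ↔
    (M.e₁ a - M.e₁ b) ^ 2 + (M.e₂ a - M.e₂ b) ^ 2 - k * (M.e₃ a - M.e₃ b) ^ 2 ≤
    (M.e₁ c - M.e₁ d) ^ 2 + (M.e₂ c - M.e₂ d) ^ 2 - k * (M.e₃ c - M.e₃ d) ^ 2 := by
  rw [M.dist_le_iff dist_nonneg, M.chord_dist]

lemma dist_eq_dist_iff {a b c d : X} : dist a b = dist c d ↔
    (M.e₁ a - M.e₁ b) ^ 2 + (M.e₂ a - M.e₂ b) ^ 2 - k * (M.e₃ a - M.e₃ b) ^ 2 =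
    (M.e₁ c - M.e₁ d) ^ 2 + (M.e₂ c - M.e₂ d) ^ 2 - k * (M.e₃ c - M.e₃ d) ^ 2 := by
  rw [M.dist_eq_iff dist_nonneg, M.chord_dist]

/-- Precomposition of a model with an isometry. -/
def comp (g : X ≃ᵢ X) : PlaneModel X k where
  hk := M.hk
  e₁ := fun z => M.e₁ (g z)
  e₂ := fun z => M.e₂ (g z)
  e₃ := fun z => M.e₃ (g z)
  pos := fun z => M.pos (g z)
  surf := fun z => M.surf (g z)
  surj := fun u v w hw h => by
    obtain ⟨z, h₁, h₂, h₃⟩ := M.surj u v w hw h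
    exact ⟨g.symm z, by simpa using h₁, by simpa using h₂, by simpa using h₃⟩
  chord_dist := fun a b => by rw [← M.chord_dist, g.dist_eq]

/-- Rotation of a model about its origin. -/
def rotate (c s : ℝ) (h : c ^ 2 + s ^ 2 = 1) : PlaneModel X k where
  hk := M.hk
  e₁ := fun z => c * M.e₁ z + s * M.e₂ z
  e₂ := fun z => -s * M.e₁ z + c * M.e₂ z
  e₃ := M.e₃
  pos := M.pos
  surf := fun z => by
    rw [M.surf z]
    linear_combination -k * (M.e₁ z ^ 2 + M.e₂ z ^ 2) * h
  surj := fun u v w hw hs => by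
    obtain ⟨z, h₁, h₂, h₃⟩ := M.surj (c * u - s * v) (s * u + c * v) w hw (by
      rw [hs]; linear_combination -k * (u ^ 2 + v ^ 2) * h)
    refine ⟨z, ?_, ?_, h₃⟩ <;> rw [h₁, h₂]
    · linear_combination u * h
    · linear_combination v * h
  chord_dist := fun a b => by
    rw [M.chord_dist]
    linear_combination -((M.e₁ a - M.e₁ b) ^ 2 + (M.e₂ a - M.e₂ b) ^ 2) * h

lemma continuous_e₁ : Continuous M.e₁ := by
  obtain ⟨a, ha₁, ha₂, ha₃⟩ := M.exists_coord 1 0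
  obtain ⟨b, hb₁, hb₂, hb₃⟩ := M.exists_coord (-1) 0
  have : M.e₁ = fun z => (chord k (dist z b) - chord k (dist z a)) / 4 := by
    ext z
    rw [M.chord_dist, M.chord_dist, ha₁, ha₂, ha₃, hb₁, hb₂, hb₃]
    ring_nf
  rw [this]
  exact (((chord_continuous k).comp (by fun_prop)).sub
    ((chord_continuous k).comp (by fun_prop))).div_const _

lemma continuous_e₂ : Continuous M.e₂ := by
  obtain ⟨a, ha₁, ha₂, ha₃⟩ := M.exists_coord 0 1
  obtain ⟨b, hb₁, hb₂, hb₃⟩ := M.exists_coord 0 (-1)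
  have : M.e₂ = fun z => (chord k (dist z b) - chord k (dist z a)) / 4 := by
    ext z
    rw [M.chord_dist, M.chord_dist, ha₁, ha₂, ha₃, hb₁, hb₂, hb₃]
    ring_nf
  rw [this]
  exact (((chord_continuous k).comp (by fun_prop)).sub
    ((chord_continuous k).comp (by fun_prop))).div_const _

lemma e₃_eq (z : X) : M.e₃ z = √(1 + k * (M.e₁ z ^ 2 + M.e₂ z ^ 2)) := by
  rw [← M.surf z, Real.sqrt_sq (M.pos z).le]

/-- The first two coordinates of a model are a homeomorphism onto the coordinate plane. -/
noncomputable def homeo : X ≃ₜ ℝ × ℝ where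
  toFun := fun z => (M.e₁ z, M.e₂ z)
  invFun := fun p => (M.exists_coord p.1 p.2).choose
  left_inv := fun z => by
    have h := (M.exists_coord (M.e₁ z) (M.e₂ z)).choose_spec
    exact M.ext_coord h.1 h.2.1 (by rw [h.2.2, ← M.e₃_eq])
  right_inv := fun p => by
    have h := (M.exists_coord p.1 p.2).choose_spec
    exact Prod.ext h.1 h.2.1
  continuous_toFun := M.continuous_e₁.prodMk M.continuous_e₂
  continuous_invFun := by
    have h := fun p : ℝ × ℝ => (M.exists_coord p.1 p.2).choose_spec
    rw [continuous_iff_continuousAt]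
    intro p
    rw [ContinuousAt, tendsto_iff_dist_tendsto_zero]
    have key : ∀ q : ℝ × ℝ, dist (M.exists_coord q.1 q.2).choose
        (M.exists_coord p.1 p.2).choose ≤ √((q.1 - p.1) ^ 2 + (q.2 - p.2) ^ 2 -
          k * (√(1 + k * (q.1 ^ 2 + q.2 ^ 2)) - √(1 + k * (p.1 ^ 2 + p.2 ^ 2))) ^ 2) := by
      intro q
      refine Real.le_sqrt_of_sq_le ((sq_le_chord k _).trans_eq ?_)
      rw [M.chord_dist, (h q).1, (h q).2.1, (h q).2.2, (h p).1, (h p).2.1, (h p).2.2]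
    refine squeeze_zero (fun _ => dist_nonneg) key ?_
    have hc : Continuous fun q : ℝ × ℝ => √((q.1 - p.1) ^ 2 + (q.2 - p.2) ^ 2 -
          k * (√(1 + k * (q.1 ^ 2 + q.2 ^ 2)) - √(1 + k * (p.1 ^ 2 + p.2 ^ 2))) ^ 2) := by
      fun_prop
    convert hc.tendsto p using 2
    simp

end PlaneModel

namespace PlaneModel

lemma e₃_euclidean (M : PlaneModel X 0) (z : X) : M.e₃ z = 1 := by
  have := M.surf z
  have := M.pos z
  nlinarith

lemma dist_sq (M : PlaneModel X 0) (a b : X) :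
    dist a b ^ 2 = (M.e₁ a - M.e₁ b) ^ 2 + (M.e₂ a - M.e₂ b) ^ 2 := by
  rw [← chord_euclidean, M.chord_dist]; ring

lemma cosh_dist (M : PlaneModel X 1) (a b : X) :
    Real.cosh (dist a b) = M.e₃ a * M.e₃ b - M.e₁ a * M.e₁ b - M.e₂ a * M.e₂ b := by
  have := M.chord_dist a b
  rw [chord_hyperbolic] at this
  linarith [M.surf a, M.surf b]

lemma btw_of_combination_hyperbolic (M : PlaneModel X 1) {a z b : X} {l m : ℝ} (hl : 0 ≤ l)
    (hm : 0 ≤ m) (h₁ : M.e₁ z = l * M.e₁ a + m * M.e₁ b)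
    (h₂ : M.e₂ z = l * M.e₂ a + m * M.e₂ b) (h₃ : M.e₃ z = l * M.e₃ a + m * M.e₃ b) :
    Btw a z b := by
  have hab := M.cosh_dist a b
  have haz := M.cosh_dist a z
  have hzb := M.cosh_dist z b
  have sa := M.surf a
  have sb := M.surf b
  have sz := M.surf z
  rw [h₁, h₂, h₃] at haz hzb sz
  set A := Real.cosh (dist a b) with hA
  have haz' : Real.cosh (dist a z) = l + m * A := by
    rw [haz, hab]; linear_combination l * sa
  have hzb' : Real.cosh (dist z b) = l * A + m := by
    rw [hzb, hab]; linear_combination m * sb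
  have hlm : l ^ 2 + m ^ 2 + 2 * l * m * A = 1 := by
    rw [hab]; linear_combination sz - l ^ 2 * sa - m ^ 2 * sb
  have s₀ : 0 ≤ Real.sinh (dist a b) := Real.sinh_nonneg_iff.2 dist_nonneg
  have s₁ : Real.sinh (dist a z) = m * Real.sinh (dist a b) := by
    refine (sq_eq_sq₀ (Real.sinh_nonneg_iff.2 dist_nonneg) (by positivity)).1 ?_
    rw [mul_pow, Real.sinh_sq, Real.sinh_sq, haz', ← hA]
    linear_combination hlm
  have s₂ : Real.sinh (dist z b) = l * Real.sinh (dist a b) := by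
    refine (sq_eq_sq₀ (Real.sinh_nonneg_iff.2 dist_nonneg) (by positivity)).1 ?_
    rw [mul_pow, Real.sinh_sq, Real.sinh_sq, hzb', ← hA]
    linear_combination hlm
  have hs : Real.cosh (dist a z + dist z b) = Real.cosh (dist a b) := by
    rw [Real.cosh_add, haz', hzb', s₁, s₂, ← hA]
    have := Real.sinh_sq (dist a b)
    rw [← hA] at this
    linear_combination A * hlm + m * l * this
  refine (chord_inj 1 (by positivity) dist_nonneg).1 ?_
  rw [chord_hyperbolic, chord_hyperbolic, hs]

lemma combination_of_btw_hyperbolic (M : PlaneModel X 1) {a z b : X} (hab : a ≠ b)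
    (h : Btw a z b) : ∃ l m : ℝ, 0 ≤ l ∧ 0 ≤ m ∧ M.e₁ z = l * M.e₁ a + m * M.e₁ b ∧
      M.e₂ z = l * M.e₂ a + m * M.e₂ b ∧ M.e₃ z = l * M.e₃ a + m * M.e₃ b := by
  unfold Btw at h
  have hd : 0 < dist a b := dist_pos.2 hab
  have hs : 0 < Real.sinh (dist a b) := Real.sinh_pos_iff.2 hd
  have s₁ : 0 ≤ Real.sinh (dist a z) := Real.sinh_nonneg_iff.2 dist_nonneg
  have s₂ : 0 ≤ Real.sinh (dist z b) := Real.sinh_nonneg_iff.2 dist_nonneg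
  have c₀ := M.cosh_dist a b
  have c₁ := M.cosh_dist a z
  have c₂ := M.cosh_dist z b
  have q₁ := Real.cosh_sq (dist a z)
  have q₂ := Real.cosh_sq (dist z b)
  have eS : Real.sinh (dist a b) = Real.sinh (dist a z) * Real.cosh (dist z b) +
      Real.cosh (dist a z) * Real.sinh (dist z b) := by rw [← h, Real.sinh_add]
  have eC : Real.cosh (dist a b) = Real.cosh (dist a z) * Real.cosh (dist z b) +
      Real.sinh (dist a z) * Real.sinh (dist z b) := by rw [← h, Real.cosh_add]
  set l := Real.sinh (dist z b) / Real.sinh (dist a b) with hl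
  set m := Real.sinh (dist a z) / Real.sinh (dist a b) with hm
  have hl' : Real.sinh (dist z b) = l * Real.sinh (dist a b) := by rw [hl]; field_simp
  have hm' : Real.sinh (dist a z) = m * Real.sinh (dist a b) := by rw [hm]; field_simp
  have hl₀ : 0 ≤ l := by positivity
  have hm₀ : 0 ≤ m := by positivity
  have hone : l * Real.cosh (dist a z) + m * Real.cosh (dist z b) = 1 := by
    rw [hl, hm]; field_simp; linarith
  have hlm : l ^ 2 + m ^ 2 + 2 * l * m * Real.cosh (dist a b) = 1 := by
    have : Real.sinh (dist z b) ^ 2 + Real.sinh (dist a z) ^ 2 +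
      2 * Real.sinh (dist z b) * Real.sinh (dist a z) * Real.cosh (dist a b) =
        Real.sinh (dist a b) ^ 2 := by
      rw [eC, eS]
      linear_combination -Real.sinh (dist z b) ^ 2 * q₁ - Real.sinh (dist a z) ^ 2 * q₂
    rw [hl, hm]; field_simp; linarith
  have sa := M.surf a
  have sb := M.surf b
  have h3 : 0 < l * M.e₃ a + m * M.e₃ b := by
    have ha := M.pos a
    have hb := M.pos b
    rcases hl₀.eq_or_lt with h0 | h0
    · rcases hm₀.eq_or_lt with h0' | h0'
      · rw [← h0, ← h0'] at hone; norm_num at hone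
      · positivity
    · positivity
  obtain ⟨w, w₁, w₂, w₃⟩ := M.surj (l * M.e₁ a + m * M.e₁ b) (l * M.e₂ a + m * M.e₂ b) _ h3 (by
    rw [c₀] at hlm
    linear_combination l ^ 2 * sa + m ^ 2 * sb + hlm)
  have hwz : w = z := by
    rw [← dist_eq_zero]
    refine (chord_inj 1 dist_nonneg le_rfl).1 ?_
    rw [chord_hyperbolic, chord_zero, M.cosh_dist, w₁, w₂, w₃]
    rw [c₁, c₂] at hone
    linear_combination 2 * hone
  subst hwz
  exact ⟨l, m, hl₀, hm₀, w₁, w₂, w₃⟩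

lemma btw_of_combination_euclidean (M : PlaneModel X 0) {a z b : X} {l m : ℝ} (hl : 0 ≤ l)
    (hm : 0 ≤ m) (h₁ : M.e₁ z = l * M.e₁ a + m * M.e₁ b)
    (h₂ : M.e₂ z = l * M.e₂ a + m * M.e₂ b) (h₃ : M.e₃ z = l * M.e₃ a + m * M.e₃ b) :
    Btw a z b := by
  simp only [e₃_euclidean, mul_one] at h₃
  have s₁ : dist a z = m * dist a b := by
    refine (sq_eq_sq₀ dist_nonneg (by positivity)).1 ?_
    rw [mul_pow, M.dist_sq, M.dist_sq, h₁, h₂, show l = 1 - m by linarith]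
    ring
  have s₂ : dist z b = l * dist a b := by
    refine (sq_eq_sq₀ dist_nonneg (by positivity)).1 ?_
    rw [mul_pow, M.dist_sq, M.dist_sq, h₁, h₂, show l = 1 - m by linarith]
    ring
  rw [Btw, s₁, s₂, ← add_mul, add_comm, ← h₃, one_mul]

lemma combination_of_btw_euclidean (M : PlaneModel X 0) {a z b : X} (hab : a ≠ b)
    (h : Btw a z b) : ∃ l m : ℝ, 0 ≤ l ∧ 0 ≤ m ∧ M.e₁ z = l * M.e₁ a + m * M.e₁ b ∧
      M.e₂ z = l * M.e₂ a + m * M.e₂ b ∧ M.e₃ z = l * M.e₃ a + m * M.e₃ b := by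
  unfold Btw at h
  have hd : 0 < dist a b := dist_pos.2 hab
  have q₀ := M.dist_sq a b
  have q₁ := M.dist_sq a z
  have q₂ := M.dist_sq z b
  set l := dist z b / dist a b with hl
  set m := dist a z / dist a b with hm
  have hl' : dist z b = l * dist a b := by rw [hl]; field_simp
  have hm' : dist a z = m * dist a b := by rw [hm]; field_simp
  have hlm : l + m = 1 := by rw [hl, hm]; field_simp; linarith
  have hsq : l * dist a z ^ 2 + m * dist z b ^ 2 - l * m * dist a b ^ 2 = 0 := by
    rw [hl', hm']; linear_combination l * m * dist a b ^ 2 * hlm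
  rw [q₀, q₁, q₂] at hsq
  have hl1 : l = 1 - m := by linarith
  have hz : (M.e₁ z - (l * M.e₁ a + m * M.e₁ b)) ^ 2 +
      (M.e₂ z - (l * M.e₂ a + m * M.e₂ b)) ^ 2 = 0 := by
    refine Eq.trans ?_ hsq
    rw [hl1]; ring
  refine ⟨l, m, by positivity, by positivity, ?_, ?_, ?_⟩
  · nlinarith [sq_nonneg (M.e₂ z - (l * M.e₂ a + m * M.e₂ b))]
  · nlinarith [sq_nonneg (M.e₁ z - (l * M.e₁ a + m * M.e₁ b))]
  · simp [e₃_euclidean, hlm]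

variable {k : ℝ} (M : PlaneModel X k)

/-- Betweenness in a model is conical combination of coordinate vectors. -/
lemma btw_iff {a z b : X} : Btw a z b ↔ ∃ l m : ℝ, 0 ≤ l ∧ 0 ≤ m ∧
    M.e₁ z = l * M.e₁ a + m * M.e₁ b ∧ M.e₂ z = l * M.e₂ a + m * M.e₂ b ∧
      M.e₃ z = l * M.e₃ a + m * M.e₃ b := by
  constructor
  · intro h
    rcases eq_or_ne a b with rfl | hab
    · have : a = z := by
        rw [Btw, dist_self, dist_comm z a] at h
        exact dist_eq_zero.1 (by linarith [dist_nonneg (x := a) (y := z)])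
      subst this
      exact ⟨1, 0, by simp⟩
    · rcases M.hk with rfl | rfl
      · exact M.combination_of_btw_euclidean hab h
      · exact M.combination_of_btw_hyperbolic hab h
  · rintro ⟨l, m, hl, hm, h₁, h₂, h₃⟩
    rcases M.hk with rfl | rfl
    · exact M.btw_of_combination_euclidean hl hm h₁ h₂ h₃
    · exact M.btw_of_combination_hyperbolic hl hm h₁ h₂ h₃

lemma dist_lt_of_btw {k : ℝ} (M : PlaneModel X k) {a z b o : X} {r : ℝ}
    (hr : 0 ≤ r) (h : Btw a z b) (hza : z ≠ a)
    (hzb : z ≠ b) (ha : dist a o ≤ r) (hb : dist b o ≤ r) : dist z o < r := by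
  obtain ⟨l, m, hl, hm, h₁, h₂, h₃⟩ := M.btw_iff.1 h
  have hne : dist a b ≠ 0 := by
    intro h0
    rw [Btw, h0] at h
    have h₁ : 0 ≤ dist a z := dist_nonneg
    have h₂ : 0 ≤ dist z b := dist_nonneg
    exact hza (dist_eq_zero.1 (by linarith : dist a z = 0)).symm
  have hdab : 0 < dist a b := lt_of_le_of_ne dist_nonneg hne.symm
  have aux : ∀ (c : X) (t : ℝ), z ≠ c → M.e₁ z = t * M.e₁ c → M.e₂ z = t * M.e₂ c →
      M.e₃ z = t * M.e₃ c → False := by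
    intro c t hc h₁ h₂ h₃
    have sz := M.surf z
    rw [h₁, h₂, h₃] at sz
    have ht : t ^ 2 = 1 := by linear_combination sz - t ^ 2 * M.surf c
    have ht0 : 0 < t := pos_of_mul_pos_left (h₃ ▸ M.pos z) (M.pos c).le
    have ht1 : t = 1 := by nlinarith
    rw [ht1, one_mul] at h₁ h₂ h₃
    exact hc (M.ext_coord h₁ h₂ h₃)
  have hl' : 0 < l := hl.lt_of_ne' fun h0 => aux b m hzb (by rw [h₁, h0]; ring)
    (by rw [h₂, h0]; ring) (by rw [h₃, h0]; ring)
  have hm' : 0 < m := hm.lt_of_ne' fun h0 => aux a l hza (by rw [h₁, h0]; ring)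
    (by rw [h₂, h0]; ring) (by rw [h₃, h0]; ring)
  rcases M.hk with rfl | rfl
  · simp only [e₃_euclidean, mul_one] at h₃
    have qa := M.dist_sq a o
    have qb := M.dist_sq b o
    have qab := M.dist_sq a b
    have qz : dist z o ^ 2 = l * dist a o ^ 2 + m * dist b o ^ 2 - l * m * dist a b ^ 2 := by
      rw [qa, qb, qab, M.dist_sq, h₁, h₂, show l = 1 - m by linarith]; ring
    have hpos : 0 < l * m * dist a b ^ 2 := by positivity
    have hA : dist a o ^ 2 ≤ r ^ 2 := by gcongr
    have hB : dist b o ^ 2 ≤ r ^ 2 := by gcongr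
    refine lt_of_pow_lt_pow_left₀ 2 hr ?_
    nlinarith
  · rw [← chord_lt_chord 1 dist_nonneg hr]
    rw [← chord_le_chord 1 dist_nonneg hr] at ha hb
    rw [chord_hyperbolic, chord_hyperbolic] at *
    have cz : Real.cosh (dist z o) =
        l * Real.cosh (dist a o) + m * Real.cosh (dist b o) := by
      rw [M.cosh_dist, M.cosh_dist, M.cosh_dist, h₁, h₂, h₃]; ring
    have hlm : l ^ 2 + m ^ 2 + 2 * l * m * Real.cosh (dist a b) = 1 := by
      have sz := M.surf z
      rw [h₁, h₂, h₃] at sz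
      rw [M.cosh_dist]
      linear_combination sz - l ^ 2 * M.surf a - m ^ 2 * M.surf b
    have h1 : 1 < Real.cosh (dist a b) := Real.one_lt_cosh.2 hne
    have hlm' : l + m < 1 := by nlinarith [mul_pos hl' hm']
    nlinarith [Real.cosh_pos r]

/-- A vector on the two-sheeted hyperboloid which is Minkowski-close to the upper sheet lies
on the upper sheet. -/
lemma pos_of_one_le_pairing {u v w b₁ b₂ b₃ : ℝ} (hw : w ^ 2 = 1 + (u ^ 2 + v ^ 2))
    (hb : b₃ ^ 2 = 1 + (b₁ ^ 2 + b₂ ^ 2)) (pb : 0 < b₃) (h : 1 ≤ w * b₃ - u * b₁ - v * b₂) :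
    0 < w := by
  by_contra! hneg
  have h1 : 0 ≤ (-w) * b₃ := mul_nonneg (by linarith) pb.le
  have h2 : (1 + (-w) * b₃) ^ 2 ≤ (u * b₁ + v * b₂) ^ 2 := by
    rw [sq_le_sq, abs_of_nonneg (by linarith)]
    exact le_trans (by linarith) (neg_le_abs _)
  have h3 : ((-w) * b₃) ^ 2 = (1 + (u ^ 2 + v ^ 2)) * (1 + (b₁ ^ 2 + b₂ ^ 2)) := by
    rw [← hw, ← hb]; ring
  nlinarith [sq_nonneg (u * b₂ - v * b₁), sq_nonneg u, sq_nonneg v, sq_nonneg b₁, sq_nonneg b₂]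

/-- The reflection interchanging two given points. -/
lemma exists_reflection {k : ℝ} (M : PlaneModel X k) {a b : X} (hab : a ≠ b) :
    ∃ σ : X ≃ᵢ X, IsReflection σ ∧ σ a = b ∧
    (∀ z, σ (σ z) = z) ∧ ∀ z, dist z a = dist z b → σ z = z := by
  obtain ⟨N, hN⟩ : ∃ N, N = (M.e₁ a - M.e₁ b) ^ 2 + (M.e₂ a - M.e₂ b) ^ 2 -
    k * (M.e₃ a - M.e₃ b) ^ 2 := ⟨_, rfl⟩
  have hNpos : 0 < N := by
    rw [hN, ← M.chord_dist, ← chord_zero k, chord_lt_chord k le_rfl dist_nonneg]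
    exact dist_pos.2 hab
  obtain ⟨c, cN⟩ : ∃ c : X → ℝ, ∀ z, c z * N = ((M.e₁ z - M.e₁ a) ^ 2 +
      (M.e₂ z - M.e₂ a) ^ 2 - k * (M.e₃ z - M.e₃ a) ^ 2) - ((M.e₁ z - M.e₁ b) ^ 2 +
      (M.e₂ z - M.e₂ b) ^ 2 - k * (M.e₃ z - M.e₃ b) ^ 2) :=
    ⟨fun z => _, fun z => div_mul_cancel₀ _ hNpos.ne'⟩
  have hex : ∀ z, ∃ w, M.e₁ w = M.e₁ z + c z * (M.e₁ a - M.e₁ b) ∧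
      M.e₂ w = M.e₂ z + c z * (M.e₂ a - M.e₂ b) ∧
      M.e₃ w = M.e₃ z + c z * (M.e₃ a - M.e₃ b) := by
    intro z
    have hcz := cN z
    have sa := M.surf a
    have sb := M.surf b
    have sz := M.surf z
    have pz := M.pos z
    have pb := M.pos b
    refine M.surj _ _ _ ?_ ?_
    · rcases M.hk with rfl | rfl
      · simp [e₃_euclidean]
      · have hza := M.cosh_dist z a
        have hone := Real.one_le_cosh (dist z a)
        rw [hN] at hcz
        refine pos_of_one_le_pairing (b₁ := M.e₁ b) (b₂ := M.e₂ b) (b₃ := M.e₃ b)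
          (u := M.e₁ z + c z * (M.e₁ a - M.e₁ b)) (v := M.e₂ z + c z * (M.e₂ a - M.e₂ b))
          ?_ (by linarith) pb ?_
        · linear_combination sz + c z * sa - c z * sb - c z * hcz
        · refine hone.trans_eq (hza.trans ?_)
          linear_combination -(hcz/2 - (1 - c z)/2*sa + (1 - c z)/2*sb)
    · rcases M.hk with rfl | rfl
      · simp [e₃_euclidean]
      · rw [hN] at hcz
        linear_combination sz + c z * sa - c z * sb - c z * hcz
  choose s s₁ s₂ s₃ using hex
  have hcc : ∀ z w, (c z - c w) * N = -2 * ((M.e₁ z - M.e₁ w) * (M.e₁ a - M.e₁ b) +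
      (M.e₂ z - M.e₂ w) * (M.e₂ a - M.e₂ b) -
      k * (M.e₃ z - M.e₃ w) * (M.e₃ a - M.e₃ b)) := fun z w => by
    linear_combination cN z - cN w
  have hiso : ∀ z w, dist (s z) (s w) = dist z w := fun z w => by
    rw [M.dist_eq_dist_iff, s₁, s₂, s₃, s₁, s₂, s₃]
    have := hcc z w
    rw [hN] at this
    linear_combination (c z - c w) * this
  have hfix : ∀ z, dist z a = dist z b → s z = z := fun z h => by
    rw [M.dist_eq_dist_iff] at h
    have : c z = 0 := (mul_eq_zero.1 ((cN z).trans (by rw [h]; ring))).resolve_right hNpos.ne'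
    exact M.ext_coord (by rw [s₁, this]; ring) (by rw [s₂, this]; ring) (by rw [s₃, this]; ring)
  have hca : c a = -1 := by
    have := cN a
    rw [hN] at this
    refine mul_right_cancel₀ hNpos.ne' ?_
    rw [hN]; linear_combination this
  have hsa : s a = b :=
    M.ext_coord (by rw [s₁, hca]; ring) (by rw [s₂, hca]; ring) (by rw [s₃, hca]; ring)
  have hinv : ∀ z, s (s z) = z := fun z => by
    have h := hcc (s z) z
    rw [s₁, s₂, s₃] at h
    have : c (s z) = - c z := by
      refine mul_right_cancel₀ hNpos.ne' ?_
      have e : (c (s z) - c z) * N = -2 * (c z * N) := by rw [h, hN]; ring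
      linear_combination e
    refine M.ext_coord ?_ ?_ ?_
    · rw [s₁, this, s₁]; ring
    · rw [s₂, this, s₂]; ring
    · rw [s₃, this, s₃]; ring
  have hsb : s b = a := by rw [← hsa, hinv]
  let σ : X ≃ᵢ X := IsometryEquiv.mk' s s hinv (Isometry.of_dist_eq hiso)
  have hσ : ∀ z, σ z = s z := fun _ => rfl
  refine ⟨σ, ⟨?_, ?_, ?_⟩, hsa, hinv, hfix⟩
  · ext z; exact hinv z
  · intro h
    have : σ a = a := by rw [h]; rfl
    exact hab (this.symm.trans hsa)
  · intro hpre
    have hopen : IsOpen {z : X | dist z a < dist z b} :=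
      isOpen_lt (by fun_prop) (by fun_prop)
    have hopen' : IsOpen {z : X | dist z b < dist z a} :=
      isOpen_lt (by fun_prop) (by fun_prop)
    obtain ⟨z, -, hz₁, hz₂⟩ := hpre _ _ hopen hopen' (fun z hz => by
        rcases lt_trichotomy (dist z a) (dist z b) with h | h | h
        · exact Or.inl h
        · exact absurd (hfix z h) hz
        · exact Or.inr h)
      ⟨a, by simpa [hσ, hsa] using hab.symm, by simpa using hab⟩
      ⟨b, by simpa [hσ, hsb] using hab, by simpa using hab.symm⟩
    exact lt_asymm (show dist z a < dist z b from hz₁) hz₂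

end PlaneModel

lemma sn_neg (k t : ℝ) : sn k (-t) = -sn k t := by unfold sn; split_ifs <;> simp

lemma exists_sn_eq (k u : ℝ) : ∃ t, sn k t = u := by
  unfold sn; split_ifs
  · exact ⟨u, rfl⟩
  · exact ⟨Real.arsinh u, Real.sinh_arsinh u⟩

lemma nonneg_of_sn_nonneg {k t : ℝ} (h : 0 ≤ sn k t) : 0 ≤ t := by
  by_contra! ht
  have := sn_pos k (neg_pos.2 ht)
  rw [sn_neg] at this
  linarith

namespace PlaneModel

variable {k : ℝ} (M : PlaneModel X k)

lemma ext_coord₂ {a b : X} (h₁ : M.e₁ a = M.e₁ b) (h₂ : M.e₂ a = M.e₂ b) : a = b :=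
  M.ext_coord h₁ h₂ (M.e₃_eq_of_sq_eq (by rw [h₁, h₂]))

lemma exists_axis (t : ℝ) : ∃ z, M.e₁ z = sn k t ∧ M.e₂ z = 0 ∧ M.e₃ z = cs k t :=
  M.surj _ _ _ (cs_pos k t) (by rw [cs_sq M.hk]; ring)

/-- The unit speed parametrization of the first coordinate axis. -/
noncomputable def axis (t : ℝ) : X := (M.exists_axis t).choose

@[simp] lemma e₁_axis (t : ℝ) : M.e₁ (M.axis t) = sn k t := (M.exists_axis t).choose_spec.1

@[simp] lemma e₂_axis (t : ℝ) : M.e₂ (M.axis t) = 0 := (M.exists_axis t).choose_spec.2.1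

@[simp] lemma e₃_axis (t : ℝ) : M.e₃ (M.axis t) = cs k t := (M.exists_axis t).choose_spec.2.2

lemma dist_axis (s t : ℝ) : dist (M.axis s) (M.axis t) = |s - t| := by
  rw [M.dist_eq_iff (abs_nonneg _), chord_abs, chord_sub M.hk]; simp

lemma isometry_axis : Isometry M.axis :=
  Isometry.of_dist_eq fun s t => by rw [M.dist_axis, Real.dist_eq]

lemma exists_eq_axis {z : X} (h : M.e₂ z = 0) : ∃ t, z = M.axis t := by
  obtain ⟨t, ht⟩ := exists_sn_eq k (M.e₁ z)
  exact ⟨t, M.ext_coord₂ (by simp [ht]) (by simp [h])⟩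

lemma exists_reflections (M : PlaneModel X k) {a b a' b' : X} (h : dist a b = dist a' b') :
    ∃ l : List (X ≃ᵢ X), (∀ σ ∈ l, IsReflection σ) ∧
      l.foldr IsometryEquiv.trans (IsometryEquiv.refl X) a = a' ∧
      l.foldr IsometryEquiv.trans (IsometryEquiv.refl X) b = b' := by
  have key : ∀ {c d : X}, dist a' c = dist a' d → ∃ l : List (X ≃ᵢ X),
      (∀ σ ∈ l, IsReflection σ) ∧
      l.foldr IsometryEquiv.trans (IsometryEquiv.refl X) a' = a' ∧
      l.foldr IsometryEquiv.trans (IsometryEquiv.refl X) c = d := by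
    intro c d hcd
    rcases eq_or_ne c d with rfl | hne
    · exact ⟨[], by simp, rfl, rfl⟩
    · obtain ⟨σ, hσ, hσc, -, hfix⟩ := M.exists_reflection hne
      exact ⟨[σ], by simpa using hσ, hfix _ hcd, hσc⟩
  rcases eq_or_ne a a' with rfl | hne
  · exact key h
  · obtain ⟨σ, hσ, hσa, -, -⟩ := M.exists_reflection hne
    obtain ⟨l, hl, h₁, h₂⟩ := key (c := σ b) (d := b') (by rw [← h, ← hσa, σ.dist_eq])
    refine ⟨σ :: l, by simpa using ⟨hσ, hl⟩, ?_, ?_⟩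
    · simpa [hσa] using h₁
    · simpa using h₂

lemma exists_equidistant (M : PlaneModel X k) (a b : X) :
    ∃ c d : X, c ≠ d ∧ dist a c = dist a d ∧ dist b c = dist b d := by
  obtain ⟨l, -, ha, hb⟩ := M.exists_reflections (a := a) (b := b) (a' := M.axis 0)
    (b' := M.axis (dist a b)) (by rw [M.dist_axis]; simp [abs_of_nonneg])
  set g := l.foldr IsometryEquiv.trans (IsometryEquiv.refl X)
  obtain ⟨c, c₁, c₂, c₃⟩ := M.exists_coord 0 1
  obtain ⟨d, d₁, d₂, d₃⟩ := M.exists_coord 0 (-1)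
  have hd : ∀ t, dist (M.axis t) c = dist (M.axis t) d := fun t => by
    rw [M.dist_eq_dist_iff, c₁, c₂, c₃, d₁, d₂, d₃]; simp
  refine ⟨g.symm c, g.symm d, ?_, ?_, ?_⟩
  · intro h
    have := g.symm.injective h
    rw [this, d₂] at c₂
    norm_num at c₂
  · rw [← g.dist_eq a, ← g.dist_eq a, ha, g.apply_symm_apply, g.apply_symm_apply, hd]
  · rw [← g.dist_eq b, ← g.dist_eq b, hb, g.apply_symm_apply, g.apply_symm_apply, hd]

/-- The orientation preserving congruences act transitively on pairs of points at a given
distance. -/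
lemma exists_orientationPreserving (M : PlaneModel X k) {a b a' b' : X}
    (h : dist a b = dist a' b') :
    ∃ ψ : X ≃ᵢ X, OrientationPreserving ψ ∧ ψ a = a' ∧ ψ b = b' := by
  obtain ⟨l, hl, ha, hb⟩ := M.exists_reflections h
  rcases Nat.even_or_odd l.length with he | ho
  · exact ⟨_, ⟨l, hl, he, rfl⟩, ha, hb⟩
  · obtain ⟨c, d, hcd, hac, hbc⟩ := M.exists_equidistant a b
    obtain ⟨ρ, hρ, -, -, hfix⟩ := M.exists_reflection hcd
    refine ⟨_, ⟨ρ :: l, by simpa using ⟨hρ, hl⟩, by simpa using ho.add_one, rfl⟩, ?_, ?_⟩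
    · simpa [hfix a hac] using ha
    · simpa [hfix b hbc] using hb

lemma orientationPreserving_refl : OrientationPreserving (IsometryEquiv.refl X) :=
  ⟨[], by simp, by simp, rfl⟩

/-- Any two points are on the first axis of some model, the first of them being the origin. -/
lemma exists_frame (M : PlaneModel X k) (a b : X) :
    ∃ M' : PlaneModel X k, M'.axis 0 = a ∧ M'.axis (dist a b) = b := by
  obtain ⟨g, -, ha, hb⟩ := M.exists_orientationPreserving (a := a) (b := b) (a' := M.axis 0)
    (b' := M.axis (dist a b)) (by rw [M.dist_axis]; simp [abs_of_nonneg])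
  refine ⟨M.comp g, (M.comp g).ext_coord₂ ?_ ?_, (M.comp g).ext_coord₂ ?_ ?_⟩
  · rw [e₁_axis]; simp [comp, ha]
  · rw [e₂_axis]; simp [comp, ha]
  · rw [e₁_axis]; simp [comp, hb]
  · rw [e₂_axis]; simp [comp, hb]

lemma eq_axis_of_btw {T : ℝ} (hT : 0 ≤ T) {w : X} (h : Btw (M.axis 0) w (M.axis T)) :
    w = M.axis (dist (M.axis 0) w) := by
  obtain ⟨l, m, hl, hm, h₁, h₂, -⟩ := M.btw_iff.1 h
  obtain ⟨t, rfl⟩ := M.exists_eq_axis (z := w) (by simpa using h₂)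
  have : 0 ≤ t := by
    refine nonneg_of_sn_nonneg (k := k) ?_
    have := sn_nonneg k hT
    rw [e₁_axis, e₁_axis, e₁_axis, sn_zero, mul_zero, zero_add] at h₁
    rw [h₁]; positivity
  rw [M.dist_axis, zero_sub, abs_neg, abs_of_nonneg this]

lemma uniqueBtwPt (M : PlaneModel X k) {a z b : X} (h : Btw a z b) : UniqueBtwPt a z b := by
  refine ⟨h, fun w hw hd => ?_⟩
  obtain ⟨M', ha, hb⟩ := M.exists_frame a b
  rw [← ha] at h hw hd
  rw [← hb] at h hw
  rw [M'.eq_axis_of_btw dist_nonneg h, M'.eq_axis_of_btw dist_nonneg hw, hd]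

/-- A congruence fixing two points of the first axis is the identity or the reflection
in that axis. -/
lemma eq_refl_or_flip {T : ℝ} (hT : T ≠ 0) (f : X ≃ᵢ X) (h0 : f (M.axis 0) = M.axis 0)
    (h1 : f (M.axis T) = M.axis T) : f = IsometryEquiv.refl X ∨
      ∀ z, M.e₁ (f z) = M.e₁ z ∧ M.e₂ (f z) = -M.e₂ z := by
  have hs : sn k T ≠ 0 := by
    rcases hT.lt_or_gt with h | h
    · have := sn_pos k (neg_pos.2 h)
      rw [sn_neg] at this
      linarith
    · exact (sn_pos k h).ne'
  have key : ∀ z, M.e₁ (f z) = M.e₁ z ∧ M.e₂ (f z) ^ 2 = M.e₂ z ^ 2 ∧ M.e₃ (f z) = M.e₃ z := by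
    intro z
    have d0 : dist (f z) (M.axis 0) = dist z (M.axis 0) := by
      conv_lhs => rw [← h0, f.dist_eq]
    have d1 : dist (f z) (M.axis T) = dist z (M.axis T) := by
      conv_lhs => rw [← h1, f.dist_eq]
    rw [M.dist_eq_dist_iff] at d0 d1
    simp only [e₁_axis, e₂_axis, e₃_axis, sn_zero, cs_zero, sub_zero] at d0 d1
    have sf := M.surf (f z)
    have sz := M.surf z
    rcases M.hk with rfl | rfl
    · simp only [e₃_euclidean, cs_euclidean, sub_self] at *
      have : sn 0 T * (M.e₁ (f z) - M.e₁ z) = 0 := by linear_combination (d0 - d1) / 2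
      have h1 : M.e₁ (f z) = M.e₁ z :=
        sub_eq_zero.1 ((mul_eq_zero.1 this).resolve_left hs)
      rw [h1] at d0
      exact ⟨h1, by linarith, trivial⟩
    · have h3 : M.e₃ (f z) = M.e₃ z := by linear_combination (d0 + sf - sz) / 2
      rw [h3] at d0 d1
      have : sn 1 T * (M.e₁ (f z) - M.e₁ z) = 0 := by linear_combination (d0 - d1) / 2
      have h1 : M.e₁ (f z) = M.e₁ z :=
        sub_eq_zero.1 ((mul_eq_zero.1 this).resolve_left hs)
      rw [h1] at d0
      exact ⟨h1, by linarith, h3⟩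
  by_cases h : ∀ z, M.e₂ (f z) = M.e₂ z
  · left
    ext z
    exact M.ext_coord₂ (key z).1 (h z)
  · right
    push Not at h
    obtain ⟨w, hw⟩ := h
    have hw' : M.e₂ (f w) = -M.e₂ w := (sq_eq_sq_iff_eq_or_eq_neg.1 (key w).2.1).resolve_left hw
    have hw0 : M.e₂ w ≠ 0 := fun h0 => hw (by rw [hw', h0, neg_zero])
    refine fun z => ⟨(key z).1, ?_⟩
    rcases sq_eq_sq_iff_eq_or_eq_neg.1 (key z).2.1 with h | h
    · have hd := f.dist_eq z w
      rw [M.dist_eq_dist_iff, (key z).1, (key w).1, (key z).2.2, (key w).2.2, h, hw'] at hd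
      have : M.e₂ w * M.e₂ z = 0 := by linear_combination hd / 4
      have := (mul_eq_zero.1 this).resolve_left hw0
      rw [h, this, neg_zero]
    · exact h

/-- The half-plane bounded by a line through the origin of the model. -/
def halfPlane (α β : ℝ) : Set X := {z | α * M.e₁ z + β * M.e₂ z ≤ 0}

lemma mem_halfPlane {α β : ℝ} {z : X} :
    z ∈ M.halfPlane α β ↔ α * M.e₁ z + β * M.e₂ z ≤ 0 := Iff.rfl

lemma halfPlane_btw {α β : ℝ} {a b z : X} (ha : a ∈ M.halfPlane α β) (hb : b ∈ M.halfPlane α β)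
    (h : Btw a z b) : z ∈ M.halfPlane α β := by
  obtain ⟨l, m, hl, hm, h₁, h₂, -⟩ := M.btw_iff.1 h
  rw [mem_halfPlane] at *
  rw [h₁, h₂]
  nlinarith [mul_nonneg hl (neg_nonneg.2 ha), mul_nonneg hm (neg_nonneg.2 hb)]

lemma gconvex_halfPlane (α β : ℝ) : GConvex (M.halfPlane α β) :=
  fun _ ha _ hb _ h => M.halfPlane_btw ha hb h.1

lemma mem_of_mem_halfPlane_mul {α β c : ℝ} (hc : 0 < c) {z : X} :
    z ∈ M.halfPlane (c * α) (c * β) ↔ z ∈ M.halfPlane α β := by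
  rw [mem_halfPlane, mem_halfPlane, show c * α * M.e₁ z + c * β * M.e₂ z =
    c * (α * M.e₁ z + β * M.e₂ z) by ring]
  exact ⟨fun h => by by_contra! h'; nlinarith, fun h => by nlinarith⟩

/-- The path through `x` along which the coordinates vary in direction `(α, β)`. -/
lemma exists_path (x : X) (α β : ℝ) : ∃ γ : ℝ → X, Continuous γ ∧ γ 0 = x ∧
    ∀ t, M.e₁ (γ t) = M.e₁ x + t * α ∧ M.e₂ (γ t) = M.e₂ x + t * β := by
  have hcoord : ∀ p : ℝ × ℝ, M.e₁ (M.homeo.symm p) = p.1 ∧ M.e₂ (M.homeo.symm p) = p.2 := by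
    intro p
    have : M.homeo (M.homeo.symm p) = p := M.homeo.apply_symm_apply p
    exact ⟨congrArg Prod.fst this, congrArg Prod.snd this⟩
  refine ⟨fun t => M.homeo.symm (M.e₁ x + t * α, M.e₂ x + t * β), ?_, ?_, fun t => hcoord _⟩
  · exact M.homeo.symm.continuous.comp (by fun_prop)
  · refine M.ext_coord₂ ?_ ?_
    · rw [(hcoord _).1]; simp
    · rw [(hcoord _).2]; simp

lemma exists_pos_mem_of_mem_interior (M : PlaneModel X k) {x : X} {A : Set X}
    (hx : x ∈ interior A) (α β : ℝ) :
    ∃ t > 0, ∃ z ∈ A, M.e₁ z = M.e₁ x + t * α ∧ M.e₂ z = M.e₂ x + t * β := by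
  obtain ⟨γ, hγ, h0, he⟩ := M.exists_path x α β
  have : ∀ᶠ t in nhds (0 : ℝ), γ t ∈ A :=
    hγ.continuousAt.eventually (by rw [h0]; exact mem_interior_iff_mem_nhds.1 hx)
  obtain ⟨t, ht, ht0⟩ := ((this.filter_mono nhdsWithin_le_nhds).and
    (self_mem_nhdsWithin (s := Set.Ioi (0 : ℝ)))).exists
  exact ⟨t, ht0, _, ht, he t⟩

lemma mem_frontier_halfPlane {α β : ℝ} (h : α ≠ 0 ∨ β ≠ 0) {x : X} :
    x ∈ frontier (M.halfPlane α β) ↔ α * M.e₁ x + β * M.e₂ x = 0 := by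
  constructor
  · intro hx
    exact frontier_le_subset_eq ((M.continuous_e₁.const_mul α).add
      (M.continuous_e₂.const_mul β)) continuous_const hx
  · intro hx
    refine ⟨subset_closure hx.le, fun hi => ?_⟩
    obtain ⟨t, ht, z, hz, h₁, h₂⟩ := M.exists_pos_mem_of_mem_interior hi α β
    rw [mem_halfPlane, h₁, h₂] at hz
    have : 0 < α ^ 2 + β ^ 2 := by
      rcases h with h | h <;> positivity
    nlinarith

lemma isHalfspace_bisector (M : PlaneModel X k) {a b : X} (hab : a ≠ b) :
    IsHalfspace {z | dist z a ≤ dist z b} := by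
  obtain ⟨σ, hσ, hσa, hinv, hfix⟩ := M.exists_reflection hab
  have hσb : σ b = a := by rw [← hσa, hinv]
  have himg : σ '' {z | dist z a ≤ dist z b} = {z | dist z b ≤ dist z a} := by
    ext z
    constructor
    · rintro ⟨w, hw, rfl⟩
      have h₁ : dist (σ w) b = dist w a := by rw [← hσa, σ.dist_eq]
      have h₂ : dist (σ w) a = dist w b := by rw [← hσb, σ.dist_eq]
      simpa [h₁, h₂] using hw
    · intro hz
      refine ⟨σ z, ?_, hinv z⟩
      have h₁ : dist (σ z) b = dist z a := by rw [← hσa, σ.dist_eq]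
      have h₂ : dist (σ z) a = dist z b := by rw [← hσb, σ.dist_eq]
      simpa [h₁, h₂] using hz
  refine ⟨σ, hσ, isClosed_le (by fun_prop) (by fun_prop), ?_, ?_⟩
  · rw [himg]
    ext z
    simpa using le_total _ _
  · rw [himg]
    ext z
    constructor
    · rintro ⟨h₁, h₂⟩
      exact hfix z (le_antisymm h₁ h₂)
    · intro h
      have h₁ : dist (σ z) b = dist z a := by rw [← hσa, σ.dist_eq]
      rw [h] at h₁
      exact ⟨h₁.ge, h₁.le⟩

lemma isHalfspace_halfPlane {α β : ℝ} (h : α ≠ 0 ∨ β ≠ 0) : IsHalfspace (M.halfPlane α β) := by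
  obtain ⟨a, a₁, a₂, a₃⟩ := M.exists_coord (-α) (-β)
  obtain ⟨b, b₁, b₂, b₃⟩ := M.exists_coord α β
  have hab : a ≠ b := by
    rintro rfl
    rcases h with h | h
    · exact h (by linarith)
    · exact h (by linarith)
  convert M.isHalfspace_bisector hab using 1
  ext z
  rw [mem_halfPlane, mem_ofPred_eq, M.dist_le_dist_iff, a₁, a₂, a₃, b₁, b₂, b₃]
  have : √(1 + k * ((-α) ^ 2 + (-β) ^ 2)) = √(1 + k * (α ^ 2 + β ^ 2)) := by simp
  rw [this]
  constructor <;> intro h <;> nlinarith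

end PlaneModel

namespace PlaneModel

variable {k : ℝ} (M : PlaneModel X k)

lemma isPreconnected_closer (M : PlaneModel X k) (a b : X) :
    IsPreconnected {z | dist z a < dist z b} := by
  by_cases hab : a = b
  · simpa [hab] using isPreconnected_empty
  refine isPreconnected_of_forall a fun y hy => ?_
  obtain ⟨M', ha, hy'⟩ := M.exists_frame a y
  refine ⟨M'.axis '' Icc 0 (dist a y), ?_, ⟨0, by simp, ha⟩, ⟨_, by simp, hy'⟩,
    isPreconnected_Icc.image _ M'.isometry_axis.continuous.continuousOn⟩
  rintro _ ⟨s, ⟨h0, h1⟩, rfl⟩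
  have d₁ : dist (M'.axis s) a = s := by
    conv_lhs => rw [← ha, M'.dist_axis, sub_zero, abs_of_nonneg h0]
  have d₂ : dist y (M'.axis s) = dist a y - s := by
    conv_lhs => rw [← hy', M'.dist_axis, abs_of_nonneg (by linarith)]
  have := dist_triangle y (M'.axis s) b
  have hy : dist y a < dist y b := hy
  rw [dist_comm y a] at hy
  show dist (M'.axis s) a < dist (M'.axis s) b
  linarith

lemma isPreconnected_compl_of_subsingleton (M : PlaneModel X k) {S : Set X}
    (hS : S.Subsingleton) : IsPreconnected Sᶜ := by
  have h : (M.homeo '' S).Countable := (hS.image _).countable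
  have := (h.isConnected_compl_of_one_lt_rank (by simp [one_add_one_eq_two])).isPreconnected
  have h2 := this.image M.homeo.symm M.homeo.symm.continuous.continuousOn
  convert h2 using 1
  rw [image_compl_eq M.homeo.symm.bijective, ← image_comp]
  simp

lemma reflection_fixed_iff (M : PlaneModel X k) {σ : X ≃ᵢ X} (hσ : IsReflection σ) {a : X}
    (ha : σ a ≠ a) (z : X) : σ z = z ↔ dist z a = dist z (σ a) := by
  obtain ⟨hinv, -, hcon⟩ := hσ
  have hinv : ∀ z, σ (σ z) = z := fun z => by
    have := congrArg (fun g : X ≃ᵢ X => g z) hinv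
    exact this
  obtain ⟨τ, -, hτa, hτ, hfix⟩ := M.exists_reflection ha.symm
  have hτb : τ (σ a) = a := by rw [← hτa, hτ]
  have hσfix : ∀ z, σ z = z → dist z a = dist z (σ a) := fun z hz => by
    conv_rhs => rw [← hz, σ.dist_eq]
  obtain ⟨M', h0, h1⟩ := M.exists_frame a (σ a)
  have hd : 0 < dist a (σ a) := dist_pos.2 ha.symm
  rcases M'.eq_refl_or_flip hd.ne' (σ.trans τ) (by simp [h0, hτb])
    (by simp [h1, hinv, hτa]) with h | h
  · have hστ : ∀ z, σ z = τ z := fun z => by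
      have := congrArg (fun g : X ≃ᵢ X => g z) h
      have : τ (σ z) = z := this
      rw [← this, hτ, this]
    exact ⟨hσfix z, fun hz => (hστ z).trans (hfix z hz)⟩
  · refine absurd ?_ hcon
    refine M.isPreconnected_compl_of_subsingleton (S := {z | σ z = z}) ?_
    have key : ∀ z, σ z = z → z = M'.axis (dist a (σ a) / 2) := by
      intro z hz
      have heq := hσfix z hz
      have h2 := (h z).2
      rw [IsometryEquiv.trans_apply, hz, hfix z heq] at h2
      obtain ⟨t, ht⟩ := M'.exists_eq_axis (z := z) (by linarith)
      rw [ht]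
      have e₁ : dist (M'.axis t) (M'.axis 0) = dist (M'.axis t) (M'.axis (dist a (σ a))) := by
        rw [h0, h1, ← ht]; exact heq
      rw [M'.dist_axis, M'.dist_axis, abs_eq_abs] at e₁
      congr 1
      rcases e₁ with e | e <;> linarith
    intro z hz w hw
    rw [key z hz, key w hw]

lemma halfspace_eq_bisector (M : PlaneModel X k) {P : Set X} (hP : IsHalfspace P) :
    ∃ a b : X, P = {z | dist z a ≤ dist z b} := by
  obtain ⟨σ, hσ, hcl, hun, hinter⟩ := hP
  obtain ⟨a₀, ha₀⟩ : ∃ a, σ a ≠ a := by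
    by_contra! h
    exact hσ.2.1 (by ext z; exact h z)
  have hinv : ∀ z, σ (σ z) = z := fun z => by
    have := congrArg (fun g : X ≃ᵢ X => g z) hσ.1
    exact this
  have hclσ : IsClosed (σ '' P) := σ.toHomeomorph.isClosedMap _ hcl
  have hmem : ∀ z, σ z ∈ σ '' P → z ∈ P := by
    rintro z ⟨w, hw, h⟩
    rwa [← σ.injective h]
  have key : ∀ a, σ a ≠ a → {z | dist z a < dist z (σ a)} ⊆ P →
      P = {z | dist z a ≤ dist z (σ a)} := by
    intro a ha hsub
    have hfix := M.reflection_fixed_iff hσ ha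
    ext z
    constructor
    · intro hz
      by_contra hlt
      have hlt : dist z (σ a) < dist z a := not_le.1 hlt
      have hσz : σ z ∈ P := hsub (by
        show dist (σ z) a < dist (σ z) (σ a)
        rw [σ.dist_eq]
        conv_lhs => rw [← hinv a, σ.dist_eq]
        exact hlt)
      have : σ z = z := by
        have : z ∈ P ∩ σ '' P := ⟨hz, σ z, hσz, hinv z⟩
        rw [hinter] at this
        exact this
      exact hlt.ne' ((hfix z).1 this)
    · intro hz
      rcases (show dist z a ≤ dist z (σ a) from hz).lt_or_eq with h | h
      · exact hsub h
      · have : z ∈ P ∩ σ '' P := by rw [hinter]; exact (hfix z).2 h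
        exact this.1
  have hfix := M.reflection_fixed_iff hσ ha₀
  rcases isPreconnected_iff_subset_of_disjoint_closed.1 (M.isPreconnected_closer a₀ (σ a₀))
    P (σ '' P) hcl hclσ (by rw [hun]; exact subset_univ _) (by
      rw [hinter]
      ext z
      simp only [mem_inter_iff, mem_ofPred_eq, hfix, mem_empty_iff_false, iff_false, not_and]
      exact fun h => h.ne) with h | h
  · exact ⟨_, _, key a₀ ha₀ h⟩
  · refine ⟨_, _, key (σ a₀) (by rw [hinv]; exact ha₀.symm) fun z hz => hmem z (h ?_)⟩
    have hz : dist z (σ a₀) < dist z (σ (σ a₀)) := hz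
    rw [hinv] at hz
    show dist (σ z) a₀ < dist (σ z) (σ a₀)
    rw [σ.dist_eq]
    conv_lhs => rw [← hinv a₀, σ.dist_eq]
    exact hz

/-- The half-spaces with the origin of the model on their boundary. -/
lemma halfspace_eq_halfPlane {P : Set X} (hP : IsHalfspace P) (h0 : M.axis 0 ∈ frontier P) :
    ∃ α β : ℝ, (α ≠ 0 ∨ β ≠ 0) ∧ P = M.halfPlane α β := by
  obtain ⟨a, b, rfl⟩ := M.halfspace_eq_bisector hP
  have heq : dist (M.axis 0) a = dist (M.axis 0) b :=
    frontier_le_subset_eq (by fun_prop) (by fun_prop) h0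
  have hset : {z | dist z a ≤ dist z b} =
      M.halfPlane (M.e₁ b - M.e₁ a) (M.e₂ b - M.e₂ a) := by
    rw [M.dist_eq_dist_iff] at heq
    simp only [e₁_axis, e₂_axis, e₃_axis, sn_zero, cs_zero, zero_sub] at heq
    ext z
    rw [mem_ofPred_eq, mem_halfPlane, M.dist_le_dist_iff]
    have sa := M.surf a
    have sb := M.surf b
    rcases M.hk with rfl | rfl
    · constructor <;> intro h <;> linarith
    · have : M.e₃ a = M.e₃ b := by linarith
      rw [this] at sa ⊢
      constructor <;> intro h <;> linarith
  refine ⟨_, _, ?_, hset⟩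
  by_contra! h
  have huniv : {z | dist z a ≤ dist z b} = univ := by
    rw [hset]
    ext z
    simp [mem_halfPlane, h.1, h.2]
  rw [huniv] at h0
  simp at h0

end PlaneModel

lemma subset_gconvexHull (Y : Set X) : Y ⊆ gconvexHull Y := fun _ hz _ hC => hC.2 hz

lemma gconvexHull_subset {Y C : Set X} (hC : GConvex C) (h : Y ⊆ C) : gconvexHull Y ⊆ C :=
  fun _ hz => hz C ⟨hC, h⟩

lemma gconvex_gconvexHull (Y : Set X) : GConvex (gconvexHull Y) :=
  fun x hx y hy z hz C hC => hC.1 x (hx C hC) y (hy C hC) z hz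

lemma segCyl_comm (a b : X) (ε : ℝ) : segCyl a b ε = segCyl b a ε := by
  rw [segCyl, segCyl, union_comm]

lemma left_mem_segCyl (a b : X) {ε : ℝ} (hε : 0 ≤ ε) : a ∈ segCyl a b ε :=
  subset_gconvexHull _ (Or.inl ⟨fun z _ => by simp, by simpa using hε⟩)

lemma right_mem_segCyl (a b : X) {ε : ℝ} (hε : 0 ≤ ε) : b ∈ segCyl a b ε := by
  rw [segCyl_comm]
  exact left_mem_segCyl b a hε

namespace PlaneModel

variable {k : ℝ} (M : PlaneModel X k)

lemma one_le_e₃ (z : X) : 1 ≤ M.e₃ z := by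
  have := M.surf z
  have := M.pos z
  rcases M.hk with rfl | rfl <;> nlinarith [sq_nonneg (M.e₁ z), sq_nonneg (M.e₂ z)]

lemma btw_mem (M : PlaneModel X k) {C : Set X} (hC : GConvex C) {a b z : X} (ha : a ∈ C)
    (hb : b ∈ C) (h : Btw a z b) : z ∈ C :=
  hC a ha b hb z (M.uniqueBtwPt h)

/-- Every conical combination of two points is proportional to a point between them. -/
lemma exists_combination (a b : X) {l m : ℝ} (hl : 0 ≤ l) (hm : 0 ≤ m) (h : 0 < l + m) :
    ∃ w, ∃ c > 0, Btw a w b ∧ l * M.e₁ a + m * M.e₁ b = c * M.e₁ w ∧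
      l * M.e₂ a + m * M.e₂ b = c * M.e₂ w ∧ l * M.e₃ a + m * M.e₃ b = c * M.e₃ w := by
  have pa := M.pos a
  have pb := M.pos b
  have sa := M.surf a
  have sb := M.surf b
  have h3 : 0 < l * M.e₃ a + m * M.e₃ b := by
    rcases hl.eq_or_lt with rfl | hl
    · have : 0 < m := by linarith
      positivity
    · positivity
  have hlt : k * ((l * M.e₁ a + m * M.e₁ b) ^ 2 + (l * M.e₂ a + m * M.e₂ b) ^ 2) <
      (l * M.e₃ a + m * M.e₃ b) ^ 2 := by
    rcases M.hk with rfl | rfl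
    · simpa using pow_pos h3 2
    · have hab : 1 ≤ M.e₃ a * M.e₃ b - M.e₁ a * M.e₁ b - M.e₂ a * M.e₂ b := by
        rw [← M.cosh_dist]
        exact Real.one_le_cosh _
      have hlm := mul_nonneg (mul_nonneg hl hm) (sub_nonneg.2 hab)
      have hpos : 0 < (l + m) ^ 2 := by positivity
      have e : (l * M.e₃ a + m * M.e₃ b) ^ 2 -
          1 * ((l * M.e₁ a + m * M.e₁ b) ^ 2 + (l * M.e₂ a + m * M.e₂ b) ^ 2) =
          (l + m) ^ 2 + 2 * (l * m *
            (M.e₃ a * M.e₃ b - M.e₁ a * M.e₁ b - M.e₂ a * M.e₂ b - 1)) := by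
        linear_combination l ^ 2 * sa + m ^ 2 * sb
      linarith
  obtain ⟨w, c, hc, h₁, h₂, h₃⟩ := M.exists_normalized h3 hlt
  refine ⟨w, c, hc, M.btw_iff.2 ⟨l / c, m / c, by positivity, by positivity, ?_, ?_, ?_⟩,
    h₁, h₂, h₃⟩
  · field_simp; linarith
  · field_simp; linarith
  · field_simp; linarith

lemma closedBall_axis_subset (M : PlaneModel X k) {S : ℝ} (hS : 0 < S) :
    closedBall (M.axis S) S ⊆ M.halfPlane (-1) 0 := by
  intro z hz
  rw [mem_closedBall, M.dist_le_iff hS.le, e₁_axis, e₂_axis, e₃_axis] at hz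
  have hc : chord k S = sn k S ^ 2 - k * (cs k S - 1) ^ 2 := by
    have := chord_sub M.hk S 0
    simpa [sn_zero, cs_zero] using this
  rw [hc] at hz
  have sp := sn_pos k hS
  have cp := cs_pos k S
  have h1 := M.one_le_e₃ z
  have sz := M.surf z
  have : 0 ≤ M.e₁ z := by
    by_contra! hneg
    have := mul_pos sp (neg_pos.2 hneg)
    rcases M.hk with rfl | rfl
    · nlinarith [sq_nonneg (M.e₁ z), sq_nonneg (M.e₂ z)]
    · nlinarith [mul_nonneg cp.le (sub_nonneg.2 h1)]
  rw [mem_halfPlane]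
  linarith

/-- A disc inside a half-plane and touching its boundary line has its centre on the
perpendicular to that line at the point of contact. -/
lemma center_perp_of_closedBall_subset (M : PlaneModel X k) {c : X} {r α β : ℝ}
    (hc : dist (M.axis 0) c = r) (h : closedBall c r ⊆ M.halfPlane α β) :
    α * M.e₂ c - β * M.e₁ c = 0 := by
  by_contra hD
  obtain ⟨v₁, v₂, hv, hcv⟩ : ∃ v₁ v₂ : ℝ, α * v₁ + β * v₂ = 1 ∧
      M.e₁ c * v₁ + M.e₂ c * v₂ = 1 := by
    refine ⟨(M.e₂ c - β) / (α * M.e₂ c - β * M.e₁ c),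
      (α - M.e₁ c) / (α * M.e₂ c - β * M.e₁ c), ?_, ?_⟩ <;>
    · rw [mul_div_assoc', mul_div_assoc', ← add_div, div_eq_one_iff_eq hD]
      ring
  have pc := M.pos c
  set V := v₁ ^ 2 + v₂ ^ 2 with hV
  have hV0 : 0 ≤ V := by positivity
  obtain ⟨t, ht, htV⟩ : ∃ t > 0, t * (V * M.e₃ c) ≤ 1 := by
    refine ⟨1 / (1 + V * M.e₃ c), by positivity, ?_⟩
    rw [div_mul_eq_mul_div, one_mul, div_le_one (by positivity)]
    linarith
  obtain ⟨z, h₁, h₂, -⟩ := M.exists_coord (t * v₁) (t * v₂)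
  have sz := M.surf z
  have sc := M.surf c
  have pz := M.pos z
  have hz : z ∈ closedBall c r := by
    rw [mem_closedBall, ← hc, M.dist_le_dist_iff]
    simp only [e₁_axis, e₂_axis, e₃_axis, sn_zero, cs_zero]
    rw [h₁, h₂] at sz ⊢
    have e1 : (t * v₁ - M.e₁ c) ^ 2 + (t * v₂ - M.e₂ c) ^ 2 =
        t ^ 2 * V - 2 * t + (M.e₁ c ^ 2 + M.e₂ c ^ 2) := by
      rw [hV]; linear_combination -2 * t * hcv
    have e2 : (t * v₁) ^ 2 + (t * v₂) ^ 2 = t ^ 2 * V := by rw [hV]; ring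
    have h3 : t * (t * (V * M.e₃ c)) ≤ t * 1 := by gcongr
    rw [e2] at sz
    rw [e1]
    rcases M.hk with rfl | rfl
    · rw [e₃_euclidean] at h3
      linarith
    · have h4 : M.e₃ z ≤ 1 + t ^ 2 * V / 2 := by
        refine le_of_sq_le_sq ?_ (by positivity)
        rw [sz]
        nlinarith [sq_nonneg (t ^ 2 * V)]
      nlinarith [mul_le_mul_of_nonneg_left h4 pc.le]
  have := h hz
  rw [mem_halfPlane, h₁, h₂] at this
  have : t * (α * v₁ + β * v₂) ≤ 0 := by linarith
  rw [hv] at this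
  linarith

lemma e₂_eq_zero_of_onLine {T : ℝ} (hT : 0 < T) {w : X}
    (h : OnLine (M.axis 0) (M.axis T) w) : M.e₂ w = 0 := by
  have hs := sn_pos k hT
  rcases h with h | h | h <;> obtain ⟨l, m, hl, hm, h₁, h₂, h₃⟩ := M.btw_iff.1 h <;>
    simp only [e₁_axis, e₂_axis, e₃_axis, sn_zero, cs_zero, mul_zero, mul_one, add_zero,
      zero_add] at h₁ h₂ h₃
  · exact h₂
  · refine (mul_eq_zero.1 h₂.symm).resolve_left ?_
    rintro rfl
    simp only [zero_mul, zero_add] at h₁ h₃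
    have : m = 0 := (mul_eq_zero.1 h₁.symm).resolve_right hs.ne'
    rw [this] at h₃
    norm_num at h₃
  · refine (mul_eq_zero.1 h₂.symm).resolve_left ?_
    rintro rfl
    simp only [zero_mul] at h₁
    exact hs.ne' h₁

lemma mem_perpDisc_axis (M : PlaneModel X k) {T ε : ℝ} (hT : 0 < T) (hε : 0 ≤ ε) {z : X}
    (h₁ : M.e₁ z = 0) (h₂ : M.e₂ z ^ 2 = sn k ε ^ 2) (h₃ : M.e₃ z = cs k ε) :
    z ∈ perpDisc (M.axis 0) (M.axis T) ε := by
  have hc := chord_sub M.hk ε 0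
  simp only [sn_zero, cs_zero, sub_zero] at hc
  constructor
  · intro w hw
    obtain ⟨t, rfl⟩ := M.exists_eq_axis (M.e₂_eq_zero_of_onLine hT hw)
    rw [M.dist_le_dist_iff, h₁, h₃]
    simp only [e₁_axis, e₂_axis, e₃_axis, sn_zero, cs_zero]
    have h1 := M.one_le_e₃ (M.axis t)
    rw [e₃_axis] at h1
    have c1 := cs_sq M.hk t
    have c2 := cs_pos k ε
    rcases M.hk with rfl | rfl
    · nlinarith [sq_nonneg (sn 0 t)]
    · nlinarith
  · rw [M.dist_le_iff hε, h₁, h₃, hc]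
    simp [h₂, sn_zero, cs_zero]

/-- The segment issuing from one end of the axis of a cylinder towards a point of the
half-plane on the side of the cylinder starts inside the cylinder. -/
lemma exists_btw_mem_segCyl (M : PlaneModel X k) {a b q : X} {ε : ℝ} (hab : a ≠ b)
    (hqa : q ≠ a) (hq : dist q b ≤ dist a b) (hε : 0 < ε) :
    ∃ z, Btw a z q ∧ z ≠ a ∧ z ∈ segCyl a b ε := by
  have hT : 0 < dist a b := dist_pos.2 hab
  set T := dist a b with hTdef
  obtain ⟨M', ha, hb⟩ := M.exists_frame a b
  rw [← hTdef] at hb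
  have q1 : 0 ≤ M'.e₁ q := by
    have := M'.closedBall_axis_subset hT (show q ∈ closedBall (M'.axis T) T by
      rw [mem_closedBall, hb]; exact hq)
    rw [mem_halfPlane] at this
    linarith
  have sT := sn_pos k hT
  have sε := sn_pos k hε
  have cT := cs_pos k T
  have cε := cs_pos k ε
  have pq := M'.pos q
  have a₁ : M'.e₁ a = 0 := by rw [← ha, e₁_axis, sn_zero]
  have a₂ : M'.e₂ a = 0 := by rw [← ha, e₂_axis]
  have a₃ : M'.e₃ a = 1 := by rw [← ha, e₃_axis, cs_zero]
  have b₁ : M'.e₁ b = sn k T := by rw [← hb, e₁_axis]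
  have b₂ : M'.e₂ b = 0 := by rw [← hb, e₂_axis]
  have b₃ : M'.e₃ b = cs k T := by rw [← hb, e₃_axis]
  have hcs := cs_sq M.hk ε
  obtain ⟨x, x₁, x₂, x₃⟩ := M'.surj 0 (sn k ε) (cs k ε) cε (by rw [hcs]; ring)
  obtain ⟨y, y₁, y₂, y₃⟩ := M'.surj 0 (-sn k ε) (cs k ε) cε (by rw [hcs]; ring)
  have hx : x ∈ segCyl a b ε := subset_gconvexHull _ (Or.inl (by
    rw [← ha, ← hb]; exact M'.mem_perpDisc_axis hT hε.le x₁ (by rw [x₂]) x₃))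
  have hy : y ∈ segCyl a b ε := subset_gconvexHull _ (Or.inl (by
    rw [← ha, ← hb]; exact M'.mem_perpDisc_axis hT hε.le y₁ (by rw [y₂, neg_sq]) y₃))
  have hb' := right_mem_segCyl a b hε.le
  have hconv : GConvex (segCyl a b ε) := gconvex_gconvexHull _
  set B := |M'.e₂ q| * cs k ε / sn k ε + M'.e₁ q * cs k T / sn k T with hB
  have hB0 : 0 ≤ B := by positivity
  set t := 1 / (1 + B) with ht
  have ht0 : 0 < t := by positivity
  have htB : t * B < 1 := by
    rw [ht, div_mul_eq_mul_div, one_mul, div_lt_one (by positivity)]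
    linarith
  set c := t * M'.e₁ q / sn k T with hc
  have hc0 : 0 ≤ c := by positivity
  set D := (1 + t * M'.e₃ q - c * cs k T) / cs k ε with hD
  have hDq : |t * M'.e₂ q / sn k ε| < D := by
    rw [abs_div, abs_mul, abs_of_pos ht0, abs_of_pos sε, hD, lt_div_iff₀ cε, hc]
    have e : t * B = t * |M'.e₂ q| / sn k ε * cs k ε + t * M'.e₁ q / sn k T * cs k T := by
      rw [hB]; field_simp
    have := mul_pos ht0 pq
    linarith
  obtain ⟨hD1, hD2⟩ := abs_lt.1 hDq
  set E := t * M'.e₂ q / sn k ε with hE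
  obtain ⟨w, cw, hcw, hw, w₁, w₂, w₃⟩ := M'.exists_combination x y
    (l := (D + E) / 2) (m := (D - E) / 2) (by linarith) (by linarith)
    (by linarith)
  rw [x₁, y₁] at w₁
  rw [x₂, y₂] at w₂
  rw [x₃, y₃] at w₃
  have hwC : w ∈ segCyl a b ε := M.btw_mem hconv hx hy hw
  obtain ⟨z, cz, hcz, hz, z₁, z₂, z₃⟩ := M'.exists_combination a q (l := 1) (m := t)
    zero_le_one ht0.le (by linarith)
  rw [a₁] at z₁
  rw [a₂] at z₂
  rw [a₃] at z₃
  have hEs : E * sn k ε = t * M'.e₂ q := by rw [hE]; field_simp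
  have hcs' : c * sn k T = t * M'.e₁ q := by rw [hc]; field_simp
  have hDc : D * cs k ε = 1 + t * M'.e₃ q - c * cs k T := by rw [hD]; field_simp
  refine ⟨z, hz, ?_, ?_⟩
  · rintro rfl
    rw [a₁] at z₁
    rw [a₂] at z₂
    have h1 : M'.e₁ q = 0 := by
      have : t * M'.e₁ q = 0 := by linarith
      exact (mul_eq_zero.1 this).resolve_left ht0.ne'
    have h2 : M'.e₂ q = 0 := by
      have : t * M'.e₂ q = 0 := by linarith
      exact (mul_eq_zero.1 this).resolve_left ht0.ne'
    exact hqa (M'.ext_coord₂ (by rw [h1, a₁]) (by rw [h2, a₂]))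
  · refine M.btw_mem hconv hwC hb' (M'.btw_iff.2 ⟨cw / cz, c / cz, by positivity,
      by positivity, ?_, ?_, ?_⟩)
    · rw [b₁]; field_simp; linarith
    · rw [b₂]; field_simp; linarith
    · rw [b₃]; field_simp; linarith

end PlaneModel

lemma sn_sub (k s t : ℝ) : sn k (s - t) = sn k s * cs k t - cs k s * sn k t := by
  unfold sn cs; split_ifs
  · ring
  · exact Real.sinh_sub s t

namespace PlaneModel

variable {k : ℝ} (M : PlaneModel X k)

lemma sub_nonneg_iff_dist_axis_le {z : X} {t : ℝ} (ht : 0 ≤ t) :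
    dist z (M.axis t) ≤ t ↔ chord k (dist z (M.axis 0)) * cs k t ≤ 2 * M.e₁ z * sn k t := by
  have hc := chord_sub M.hk t 0
  simp only [sn_zero, cs_zero, sub_zero] at hc
  rw [M.dist_le_iff ht, M.chord_dist, hc]
  simp only [e₁_axis, e₂_axis, e₃_axis, sn_zero, cs_zero]
  have sz := M.surf z
  have st := cs_sq M.hk t
  rcases M.hk with rfl | rfl
  · simp only [e₃_euclidean, cs_euclidean]
    constructor <;> intro h <;> linarith
  · have e : ((M.e₁ z - 0) ^ 2 + (M.e₂ z - 0) ^ 2 - 1 * (M.e₃ z - 1) ^ 2) * cs 1 t =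
        2 * (M.e₃ z - 1) * cs 1 t := by linear_combination -cs 1 t * sz
    rw [e]
    constructor <;> intro h <;> linarith

lemma sub_pos_iff_dist_axis_lt {z : X} {t : ℝ} (ht : 0 ≤ t) :
    dist z (M.axis t) < t ↔ chord k (dist z (M.axis 0)) * cs k t < 2 * M.e₁ z * sn k t := by
  have hc := chord_sub M.hk t 0
  simp only [sn_zero, cs_zero, sub_zero] at hc
  rw [M.dist_lt_iff ht, M.chord_dist, hc]
  simp only [e₁_axis, e₂_axis, e₃_axis, sn_zero, cs_zero]
  have sz := M.surf z
  have st := cs_sq M.hk t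
  rcases M.hk with rfl | rfl
  · simp only [e₃_euclidean, cs_euclidean]
    constructor <;> intro h <;> linarith
  · have e : ((M.e₁ z - 0) ^ 2 + (M.e₂ z - 0) ^ 2 - 1 * (M.e₃ z - 1) ^ 2) * cs 1 t =
        2 * (M.e₃ z - 1) * cs 1 t := by linear_combination -cs 1 t * sz
    rw [e]
    constructor <;> intro h <;> linarith

/-- Internally tangent discs are nested, with no other common boundary point. -/
lemma eq_or_dist_lt_of_btw (M : PlaneModel X k) {a p o z : X} (h : Btw a p o) (hp : p ≠ o)
    (hz : dist z p ≤ dist a p) : z = a ∨ dist z o < dist a o := by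
  obtain ⟨M', ha, ho⟩ := M.exists_frame a o
  have hpR : p = M'.axis (dist a p) := by
    rw [← ha, ← ho] at h
    have := M'.eq_axis_of_btw dist_nonneg h
    rwa [ha] at this
  have hRt : dist a p < dist a o := by
    have : 0 < dist p o := dist_pos.2 hp
    unfold Btw at h
    linarith
  rw [or_iff_not_imp_left]
  intro hza
  have hd : 0 < chord k (dist z (M'.axis 0)) := by
    have := (chord_lt_chord k le_rfl dist_nonneg).2 (dist_pos.2 hza)
    rwa [chord_zero, ← ha] at this
  set R := dist a p
  set t := dist a o
  have hR : 0 ≤ R := dist_nonneg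
  have ht : 0 ≤ t := dist_nonneg
  rw [hpR, M'.sub_nonneg_iff_dist_axis_le hR] at hz
  rw [← ho, M'.sub_pos_iff_dist_axis_lt ht]
  have c1 := cs_pos k R
  have c2 := cs_pos k t
  have s1 := sn_nonneg k hR
  have hs := sn_pos k (sub_pos.2 hRt)
  rw [sn_sub] at hs
  have h1 : 0 < 2 * M'.e₁ z * sn k R := lt_of_lt_of_le (mul_pos hd c1) hz
  have h2 : 0 < 2 * M'.e₁ z := pos_of_mul_pos_left h1 s1
  have h3 : chord k (dist z (M'.axis 0)) * cs k t * cs k R < 2 * M'.e₁ z * sn k t * cs k R := by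
    nlinarith [mul_pos h2 hs, mul_le_mul_of_nonneg_right hz c2.le]
  exact lt_of_mul_lt_mul_right h3 c1.le

/-- Far discs of a fixed radius centred on the axis lie in a given half-plane. -/
lemma exists_closedBall_axis_subset (M : PlaneModel X k) {S : ℝ} (hS : 0 < S) (s : ℝ) :
    ∃ T₀, ∀ T ≥ T₀, closedBall (M.axis (T - S)) S ⊆ M.halfPlane (-1) s := by
  rcases M.hk with rfl | rfl
  · refine ⟨|s| * S + 2 * S, fun T hT z hz => ?_⟩
    rw [mem_closedBall, M.dist_le_iff hS.le, e₁_axis, e₂_axis, e₃_axis, e₃_euclidean,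
      chord_euclidean, sn_euclidean, cs_euclidean] at hz
    have h1 : |M.e₁ z - (T - S)| ≤ S := by
      apply abs_le_of_sq_le_sq _ hS.le
      nlinarith [sq_nonneg (M.e₂ z - 0)]
    have h2 : |M.e₂ z| ≤ S := by
      apply abs_le_of_sq_le_sq _ hS.le
      nlinarith [sq_nonneg (M.e₁ z - (T - S))]
    have h3 : s * M.e₂ z ≤ |s| * S :=
      (le_abs_self _).trans (by rw [abs_mul]; gcongr)
    rw [mem_halfPlane]
    linarith [(abs_le.1 h1).1]
  · obtain ⟨η, hη0, hη1, hη⟩ : ∃ η : ℝ, 0 ≤ η ∧ η < 1 ∧ s ^ 2 = η ^ 2 * (1 + s ^ 2) := by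
      have hp : 0 < 1 + s ^ 2 := by positivity
      refine ⟨√(s ^ 2 / (1 + s ^ 2)), Real.sqrt_nonneg _, ?_, ?_⟩
      · rw [Real.sqrt_lt' one_pos, div_lt_iff₀ hp]; linarith
      · rw [Real.sq_sqrt (by positivity)]; field_simp
    have hη' : 0 < 1 - η := by linarith
    refine ⟨S + Real.cosh S / (1 - η), fun T hT z hz => ?_⟩
    rw [mem_closedBall, M.dist_le_iff hS.le, e₁_axis, e₂_axis, e₃_axis,
      chord_hyperbolic, sn_hyperbolic, cs_hyperbolic] at hz
    have hT' : 0 ≤ T - S := by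
      have : 0 ≤ Real.cosh S / (1 - η) := by positivity
      linarith
    have sh0 : T - S ≤ Real.sinh (T - S) := Real.self_le_sinh_iff.2 hT'
    have shc : Real.sinh (T - S) < Real.cosh (T - S) := Real.sinh_lt_cosh _
    have hC : Real.cosh S < Real.cosh (T - S) * (1 - η) := by
      rw [← div_lt_iff₀ hη']; linarith
    have sz := M.surf z
    have h1 := M.one_le_e₃ z
    have hsq := Real.cosh_sq (T - S)
    have hz' : M.e₃ z * Real.cosh (T - S) - M.e₁ z * Real.sinh (T - S) ≤ Real.cosh S := by
      linarith
    rw [mem_halfPlane]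
    by_contra! hlt
    have cp := Real.cosh_pos (T - S)
    have key : M.e₁ z * Real.sinh (T - S) ≤ η * M.e₃ z * Real.cosh (T - S) := by
      rcases le_or_gt (M.e₁ z) 0 with hneg | hpos
      · exact (mul_nonpos_of_nonpos_of_nonneg hneg (by linarith)).trans (by positivity)
      · have h2 : M.e₁ z ^ 2 ≤ (s * M.e₂ z) ^ 2 := by gcongr; linarith
        have h3 : M.e₁ z ≤ η * M.e₃ z := by
          refine le_of_sq_le_sq ?_ (by positivity)
          have hp : 0 < 1 + s ^ 2 := by positivity
          refine le_of_mul_le_mul_right ?_ hp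
          nlinarith [sq_nonneg s]
        gcongr
    nlinarith [mul_le_mul_of_nonneg_right h1 (mul_pos cp hη').le]

lemma uniqueDiametral_hull (M : PlaneModel X k) {Y : Set X} {x y o : X} (hx : x ∈ Y)
    (hy : y ∈ Y) (hxy : x ≠ y) (hxo : dist x o = dist x y / 2) (hyo : dist y o = dist x y / 2)
    (h : ∀ z ∈ Y, z = x ∨ z = y ∨ dist z o < dist x y / 2) :
    UniqueDiametral (gconvexHull Y) x y ∧ diam (gconvexHull Y) = dist x y ∧
      ∀ a ∈ gconvexHull Y, ∀ b ∈ gconvexHull Y, dist a b ≤ dist x y := by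
  have hT : 0 < dist x y := dist_pos.2 hxy
  have hle : ∀ z, (z = x ∨ z = y ∨ dist z o < dist x y / 2) → dist z o ≤ dist x y / 2 := by
    rintro z (rfl | rfl | hz)
    · exact hxo.le
    · exact hyo.le
    · exact hz.le
  have hsub : gconvexHull Y ⊆ {z | z = x ∨ z = y ∨ dist z o < dist x y / 2} := by
    refine gconvexHull_subset (fun a ha b hb z hz => ?_) h
    by_cases hza : z = a
    · rwa [hza]
    by_cases hzb : z = b
    · rwa [hzb]
    exact Or.inr (Or.inr (M.dist_lt_of_btw (by linarith) hz.1 hza hzb (hle a ha) (hle b hb)))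
  have hdle : ∀ a ∈ gconvexHull Y, ∀ b ∈ gconvexHull Y, dist a b ≤ dist x y := by
    intro a ha b hb
    have := dist_triangle_right a b o
    linarith [hle a (hsub ha), hle b (hsub hb)]
  have hxh := subset_gconvexHull Y hx
  have hyh := subset_gconvexHull Y hy
  have hdiam : diam (gconvexHull Y) = dist x y := by
    refine le_antisymm (diam_le_of_forall_dist_le hT.le hdle) ?_
    refine dist_le_diam_of_mem ?_ hxh hyh
    exact isBounded_iff.2 ⟨dist x y, fun a ha b hb => hdle a ha b hb⟩
  refine ⟨⟨hxh, hyh, hxy, hdiam.symm, fun a ha b hb hab => ?_⟩, hdiam, hdle⟩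
  rw [hdiam] at hab
  have htri := dist_triangle_right a b o
  have ha' := hle a (hsub ha)
  have hb' := hle b (hsub hb)
  have hab' : a ≠ b := dist_pos.1 (hab ▸ hT)
  rcases hsub ha with rfl | rfl | ha
  · rcases hsub hb with rfl | rfl | hb
    · exact absurd rfl hab'
    · exact Or.inl ⟨rfl, rfl⟩
    · linarith
  · rcases hsub hb with rfl | rfl | hb
    · exact Or.inr ⟨rfl, rfl⟩
    · exact absurd rfl hab'
    · linarith
  · linarith

lemma isCompact_closedBall (M : PlaneModel X k) (p : X) (R : ℝ) : IsCompact (closedBall p R) := by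
  obtain ⟨M', h0, -⟩ := M.exists_frame p p
  have hE : ∀ z ∈ closedBall p R, M'.e₁ z ^ 2 + M'.e₂ z ^ 2 ≤ (1 + chord k R) ^ 2 := by
    intro z hz
    have hR : 0 ≤ R := dist_nonneg.trans hz
    rw [mem_closedBall, ← h0, M'.dist_le_iff hR] at hz
    simp only [e₁_axis, e₂_axis, e₃_axis, sn_zero, cs_zero, sub_zero] at hz
    have hc : 0 ≤ chord k R := (sq_nonneg R).trans (sq_le_chord k R)
    have sz := M'.surf z
    have h1 := M'.one_le_e₃ z
    rcases M'.hk with rfl | rfl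
    · nlinarith
    · have : M'.e₃ z ≤ 1 + chord 1 R := by nlinarith
      nlinarith
  have himg : M'.homeo '' closedBall p R ⊆ closedBall 0 |1 + chord k R| := by
    rintro _ ⟨z, hz, rfl⟩
    have := hE z hz
    rw [mem_closedBall, dist_zero_right, Prod.norm_def]
    refine max_le ?_ ?_ <;> rw [Real.norm_eq_abs, ← sq_le_sq]
    · exact le_trans (le_add_of_nonneg_right (sq_nonneg (M'.e₂ z))) this
    · exact le_trans (le_add_of_nonneg_left (sq_nonneg (M'.e₁ z))) this
  have hc : IsCompact (M'.homeo '' closedBall p R) :=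
    (ProperSpace.isCompact_closedBall _ _).of_isClosed_subset
      (M'.homeo.isClosedMap _ isClosed_closedBall) himg
  exact (M'.homeo.isCompact_image).1 hc

/-- Every bounded closed proper subset with interior points contains a disc touching its
boundary. -/
lemma exists_inner_closedBall (M : PlaneModel X k) {L : Set X} (hcl : IsClosed L)
    (hinter : (interior L).Nonempty) (hpr : L ≠ univ) {p : X} {R : ℝ} (hb : L ⊆ closedBall p R) :
    ∃ y ∈ frontier L, ∃ c, 0 < dist y c ∧ closedBall c (dist y c) ⊆ L := by
  obtain ⟨c, hc⟩ := hinter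
  have : PreconnectedSpace X :=
    ⟨by simpa using M.isPreconnected_compl_of_subsingleton subsingleton_empty⟩
  have hfn : (frontier L).Nonempty :=
    nonempty_frontier_iff.2 ⟨⟨c, interior_subset hc⟩, hpr⟩
  have hfL : frontier L ⊆ L := hcl.frontier_subset
  have hfc : IsCompact (frontier L) :=
    (M.isCompact_closedBall p R).of_isClosed_subset isClosed_frontier (hfL.trans hb)
  obtain ⟨y, hy, hmin⟩ := hfc.exists_isMinOn hfn
    (f := fun z => dist z c) (by fun_prop)
  refine ⟨y, hy, c, dist_pos.2 ?_, fun z hz => ?_⟩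
  · rintro rfl
    exact hy.2 hc
  · by_contra hzL
    obtain ⟨M', h0, h1⟩ := M.exists_frame c z
    have hpre : IsPreconnected (M'.axis '' Icc 0 (dist c z)) :=
      isPreconnected_Icc.image _ M'.isometry_axis.continuous.continuousOn
    obtain ⟨_, ⟨t, ht, rfl⟩, hw⟩ : (M'.axis '' Icc 0 (dist c z) ∩ frontier L).Nonempty := by
      by_contra! hemp
      have hcover : M'.axis '' Icc 0 (dist c z) ⊆ interior L ∪ Lᶜ := by
        intro w hw
        by_contra hcon
        simp only [mem_union, mem_compl_iff, not_or, not_not] at hcon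
        exact (eq_empty_iff_forall_notMem.1 hemp w) ⟨hw, subset_closure hcon.2, hcon.1⟩
      obtain ⟨w, -, hw1, hw2⟩ := hpre (interior L) Lᶜ isOpen_interior hcl.isOpen_compl
        hcover ⟨c, ⟨0, by simp, h0⟩, hc⟩ ⟨z, ⟨_, by simp, h1⟩, hzL⟩
      exact hw2 (interior_subset hw1)
    have htz : t ≠ dist c z := by
      rintro rfl
      rw [h1] at hw
      exact hzL (hfL hw)
    have hle : dist y c ≤ dist (M'.axis t) c := hmin hw
    have hdt : dist (M'.axis t) c = t := by
      conv_lhs => rw [← h0, M'.dist_axis, sub_zero, abs_of_nonneg ht.1]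
    have := lt_of_le_of_ne ht.2 htz
    rw [mem_closedBall, dist_comm] at hz
    linarith

end PlaneModel

namespace PlaneModel

variable {k : ℝ} (M : PlaneModel X k)

lemma not_isSphereSpace (M : PlaneModel X k) : ¬ IsSphereSpace X 2 := by
  rintro ⟨e, -, -, he⟩
  have h := M.dist_axis 4 0
  rw [he] at h
  norm_num at h
  linarith [Real.arccos_le_pi (inner ℝ (e (M.axis 4)) (e (M.axis 0))), Real.pi_lt_d2]

/-- A congruence preserving the part of a convex set near `a` maps the whole set into each
half-plane supporting the set at the image of `a`. -/
lemma map_mem_halfPlane (M : PlaneModel X k) {H : Set X} (hH : GConvex H) {α β ε : ℝ}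
    (hHs : H ⊆ M.halfPlane α β) {a b q : X} (hab : a ≠ b) (ha : a ∈ H) (hq : q ∈ H)
    (hqb : dist q b ≤ dist a b) (hε : 0 < ε) (f : X ≃ᵢ X)
    (hf : ∀ z ∈ H ∩ segCyl a b ε, f z ∈ H) (hfa : f a = M.axis 0) :
    f q ∈ M.halfPlane α β := by
  by_cases hqa : q = a
  · rw [hqa, hfa, mem_halfPlane]
    simp [sn_zero]
  obtain ⟨z, hz, hza, hzc⟩ := M.exists_btw_mem_segCyl hab hqa hqb hε
  have h1 := hHs (hf z ⟨M.btw_mem hH ha hq hz, hzc⟩)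
  have h2 : Btw (M.axis 0) (f z) (f q) := by
    rw [← hfa]
    unfold Btw at hz ⊢
    simpa only [f.isometry.dist_eq] using hz
  obtain ⟨l, m, hl, hm, e1, e2, -⟩ := M.btw_iff.1 h2
  simp only [e₁_axis, e₂_axis, sn_zero, mul_zero, zero_add] at e1 e2
  have hm0 : m ≠ 0 := by
    rintro rfl
    refine hza (f.injective ?_)
    rw [hfa]
    exact M.ext_coord₂ (by simp [e1, sn_zero]) (by simp [e2])
  rw [mem_halfPlane, e1, e2] at h1
  rw [mem_halfPlane]
  have hm1 : 0 < m := lt_of_le_of_ne hm hm0.symm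
  by_contra! hlt
  nlinarith [mul_pos hm1 hlt]

/-- At a boundary point of `K`, the cone of half-planes supporting `K` is symmetric with respect
to the normal of each supporting disc. -/
lemma halfPlane_flip (M : PlaneModel X k) {K L : Set X} {R s : ℝ} (h6 : T8Cond6 K L)
    (hx : M.axis 0 ∈ frontier K) (hxK : M.axis 0 ∈ K) (hR : 0 < R)
    (hK : K ⊆ closedBall (M.axis R) R) {y c q : X} (hy : y ∈ frontier L) (hyL : y ∈ L)
    (hyc : 0 < dist y c) (hc : closedBall c (dist y c) ⊆ L) (hyq : 0 < dist y q)
    (hL : L ⊆ closedBall q (dist y q)) (hs : s ≠ 0) (hKs : K ⊆ M.halfPlane (-1) s) :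
    K ⊆ M.halfPlane (-1) (-s) := by
  obtain ⟨δ, hδ, h6⟩ := h6
  set S := dist y q with hS
  obtain ⟨T₀, hT₀⟩ := M.exists_closedBall_axis_subset hyq s
  obtain ⟨T, hTR, hTS, hTδ, hTT⟩ : ∃ T, 2 * R < T ∧ 2 * S < T ∧ 1 / δ < T ∧ T₀ ≤ T := by
    refine ⟨max (max (2 * R) (2 * S)) (max (1 / δ) T₀) + 1, ?_, ?_, ?_, ?_⟩ <;>
      simp [max_def] <;> split_ifs <;> linarith
  have hT : 0 < T := by linarith
  have d0 : ∀ {u v : ℝ}, v ≤ u → dist (M.axis u) (M.axis v) = u - v := fun h => by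
    rw [M.dist_axis, abs_of_nonneg (sub_nonneg.2 h)]
  have d1 : ∀ {u v : ℝ}, u ≤ v → dist (M.axis u) (M.axis v) = v - u := fun h => by
    rw [dist_comm, d0 h]
  obtain ⟨ψ, hψ, hψy, hψq⟩ := M.exists_orientationPreserving (a := y) (b := q)
    (a' := M.axis T) (b' := M.axis (T - S)) (by rw [d0 (by linarith)]; ring)
  have hB : ψ '' L ⊆ closedBall (M.axis (T - S)) S := by
    rintro _ ⟨z, hz, rfl⟩
    rw [mem_closedBall, ← hψq, ψ.isometry.dist_eq]
    exact hL hz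
  set A := IsometryEquiv.refl X '' K with hA
  have hAK : A = K := image_id K
  set H := hullUnion K L (IsometryEquiv.refl X) ψ with hH
  have hHY : H = gconvexHull (A ∪ ψ '' L) := rfl
  have hne : M.axis 0 ≠ M.axis T := by
    rw [← dist_pos, d1 hT.le]; linarith
  have hxA : M.axis 0 ∈ A := by rwa [hAK]
  have hyB : M.axis T ∈ ψ '' L := ⟨y, hyL, hψy⟩
  have dT : dist (M.axis 0) (M.axis T) = T := by rw [d1 hT.le, sub_zero]
  obtain ⟨hud, hdiam, hdle⟩ := M.uniqueDiametral_hull (Y := A ∪ ψ '' L) (o := M.axis (T / 2))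
    (Or.inl hxA) (Or.inr hyB) hne (by rw [dT, d1 (by linarith)]; ring)
    (by rw [dT, d0 (by linarith)]; ring) (by
      rw [dT]
      rintro z (hz | hz)
      · have := M.eq_or_dist_lt_of_btw (a := M.axis 0) (p := M.axis R) (o := M.axis (T / 2))
          (z := z) (by unfold Btw; rw [d1 hR.le, d1 (by linarith), d1 (by linarith)]; ring)
          (by rw [← dist_pos, d1 (by linarith)]; linarith)
          (by rw [d1 hR.le, sub_zero]; rw [hAK] at hz; exact hK hz)
        rw [d1 (by linarith), sub_zero] at this
        tauto
      · have := M.eq_or_dist_lt_of_btw (a := M.axis T) (p := M.axis (T - S)) (o := M.axis (T / 2))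
          (z := z)
          (by unfold Btw; rw [d0 (by linarith), d0 (by linarith), d0 (by linarith)]; ring)
          (by rw [← dist_pos, d0 (by linarith)]; linarith)
          (by rw [d0 (by linarith), sub_sub_cancel]; exact hB hz)
        rw [d0 (by linarith), sub_half] at this
        tauto)
  rw [← hHY] at hud hdiam hdle
  rw [dT] at hdiam hdle
  have hns := M.not_isSphereSpace
  obtain ⟨ε₀, hε₀, h6⟩ := h6 (IsometryEquiv.refl X) ψ
    ⟨orientationPreserving_refl, hψ, fun h => absurd h hns⟩ (M.axis 0) hx y hy
    ⟨fun h => absurd h hns, fun _ => by rw [← hH, hdiam]; exact hTδ⟩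
    (by rw [hψy]; exact hud)
  obtain ⟨-, f, hf, hfS⟩ := h6 (ε₀ / 2) (by linarith) (by linarith)
  rw [hψy, ← hH] at hfS
  set ε := ε₀ / 2
  change f '' (H ∩ segCyl (M.axis 0) (M.axis T) ε) = H ∩ segCyl (M.axis 0) (M.axis T) ε at hfS
  have hε : 0 < ε := by positivity
  have hHc : GConvex H := gconvex_gconvexHull _
  have hAH : A ⊆ H := fun z hz => subset_gconvexHull _ (Or.inl hz)
  have hBH : ψ '' L ⊆ H := fun z hz => subset_gconvexHull _ (Or.inr hz)
  have hHs : H ⊆ M.halfPlane (-1) s := by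
    refine gconvexHull_subset (M.gconvex_halfPlane _ _)
      (union_subset (hAK.subset.trans hKs) (hB.trans (hT₀ T hTT)))
  have hfH : ∀ z ∈ H ∩ segCyl (M.axis 0) (M.axis T) ε, f z ∈ H :=
    fun z hz => (hfS.subset ⟨z, hz, rfl⟩).1
  have hxS : M.axis 0 ∈ H ∩ segCyl (M.axis 0) (M.axis T) ε :=
    ⟨hAH hxA, left_mem_segCyl _ _ hε.le⟩
  have hyS : M.axis T ∈ H ∩ segCyl (M.axis 0) (M.axis T) ε :=
    ⟨hBH hyB, right_mem_segCyl _ _ hε.le⟩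
  rcases hud.2.2.2.2 _ (hfH _ hxS) _ (hfH _ hyS)
    (by rw [f.isometry.dist_eq, dT, hdiam]) with ⟨hfx, hfy⟩ | ⟨hfx, hfy⟩
  · intro z hz
    have hzH : z ∈ H := hAH (by rwa [hAK])
    have h1 : f z ∈ M.halfPlane (-1) s :=
      M.map_mem_halfPlane hHc hHs hne hxS.1 hzH
        (by rw [dT]; exact hdle z hzH _ hyS.1) hε f hfH hfx
    rcases M.eq_refl_or_flip hT.ne' f hfx hfy with h | h
    · exact absurd h hf
    · rw [mem_halfPlane, (h z).1, (h z).2] at h1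
      rw [mem_halfPlane]
      linarith
  · exfalso
    have hcd : dist (M.axis 0) (f (ψ c)) = dist y c := by
      rw [← hfy, f.isometry.dist_eq, ← hψy, ψ.isometry.dist_eq]
    have hball : ∀ w ∈ closedBall (f (ψ c)) (dist y c), ∃ z ∈ ψ '' L, f z = w := by
      intro w hw
      obtain ⟨z, rfl⟩ := f.surjective w
      obtain ⟨z, rfl⟩ := ψ.surjective z
      rw [mem_closedBall, f.isometry.dist_eq, ψ.isometry.dist_eq] at hw
      exact ⟨_, ⟨z, hc hw, rfl⟩, rfl⟩
    have h1 : closedBall (f (ψ c)) (dist y c) ⊆ M.halfPlane (-1) s := by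
      intro w hw
      obtain ⟨z, hz, rfl⟩ := hball w hw
      refine M.map_mem_halfPlane hHc hHs hne.symm hyS.1 (hBH hz)
        (by rw [dist_comm (M.axis T), dT]; exact hdle z (hBH hz) _ hxS.1) hε f ?_ hfy
      rw [segCyl_comm]
      exact hfH
    have h2 : closedBall (f (ψ c)) (dist y c) ⊆ M.halfPlane (-1) 0 := by
      intro w hw
      obtain ⟨z, hz, rfl⟩ := hball w hw
      refine M.closedBall_axis_subset hT ?_
      rw [mem_closedBall, ← hfx, f.isometry.dist_eq]
      exact hdle z (hBH hz) _ hxS.1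
    have p1 := M.center_perp_of_closedBall_subset hcd h1
    have p2 := M.center_perp_of_closedBall_subset hcd h2
    have q2 : M.e₂ (f (ψ c)) = 0 := by linarith
    have q1 : M.e₁ (f (ψ c)) = 0 := by
      rw [q2] at p1
      simpa [hs] using p1
    have : f (ψ c) = M.axis 0 := M.ext_coord₂ (by simp [q1, sn_zero]) (by simp [q2])
    rw [this, dist_self] at hcd
    linarith

end PlaneModel

namespace PlaneModel

variable {k : ℝ} (M : PlaneModel X k)

lemma dist_le_dist_axis_zero_iff {z p : X} :
    dist z p ≤ dist (M.axis 0) p ↔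
      chord k (dist z (M.axis 0)) * M.e₃ p ≤ 2 * (M.e₁ z * M.e₁ p + M.e₂ z * M.e₂ p) := by
  rw [M.dist_le_dist_iff, M.chord_dist]
  simp only [e₁_axis, e₂_axis, e₃_axis, sn_zero, cs_zero]
  have sz := M.surf z
  rcases M.hk with rfl | rfl
  · simp only [e₃_euclidean]
    constructor <;> intro h <;> linarith
  · have e : ((M.e₁ z - 0) ^ 2 + (M.e₂ z - 0) ^ 2 - 1 * (M.e₃ z - 1) ^ 2) * M.e₃ p =
        2 * (M.e₃ z - 1) * M.e₃ p := by linear_combination -M.e₃ p * sz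
    rw [e]
    constructor <;> intro h <;> linarith

lemma axis_zero_eq_iff {z : X} : z = M.axis 0 ↔ M.e₁ z = 0 ∧ M.e₂ z = 0 := by
  constructor
  · rintro rfl
    simp [sn_zero]
  · rintro ⟨h1, h2⟩
    exact M.ext_coord₂ (by simp [h1, sn_zero]) (by simp [h2])

lemma exists_rotate {p : X} (hp : 0 < M.e₁ p ^ 2 + M.e₂ p ^ 2) :
    ∃ g > 0, ∃ M' : PlaneModel X k, M'.axis 0 = M.axis 0 ∧
      M'.axis (dist p (M.axis 0)) = p ∧
      (∀ z, M'.e₁ z = g * (M.e₁ p * M.e₁ z + M.e₂ p * M.e₂ z)) ∧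
      ∀ z, M'.e₂ z = g * (M.e₁ p * M.e₂ z - M.e₂ p * M.e₁ z) := by
  set N := √(M.e₁ p ^ 2 + M.e₂ p ^ 2) with hN
  have hN0 : 0 < N := Real.sqrt_pos.2 hp
  have hN2 : N ^ 2 = M.e₁ p ^ 2 + M.e₂ p ^ 2 := Real.sq_sqrt hp.le
  have h1 : (M.e₁ p / N) ^ 2 + (M.e₂ p / N) ^ 2 = 1 := by
    field_simp
    exact hN2.symm
  refine ⟨N⁻¹, inv_pos.2 hN0, M.rotate (M.e₁ p / N) (M.e₂ p / N) h1, ?_⟩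
  set M' := M.rotate (M.e₁ p / N) (M.e₂ p / N) h1
  have he1 : ∀ z, M'.e₁ z = N⁻¹ * (M.e₁ p * M.e₁ z + M.e₂ p * M.e₂ z) := fun z => by
    simp only [M', rotate]; ring
  have he2 : ∀ z, M'.e₂ z = N⁻¹ * (M.e₁ p * M.e₂ z - M.e₂ p * M.e₁ z) := fun z => by
    simp only [M', rotate]; ring
  have h0 : M'.axis 0 = M.axis 0 := by
    symm
    rw [axis_zero_eq_iff, he1, he2]
    simp [sn_zero]
  obtain ⟨t, ht⟩ := M'.exists_eq_axis (z := p) (by rw [he2]; ring)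
  have hsn : sn k t = N := by
    rw [← M'.e₁_axis, ← ht, he1]
    field_simp
    linarith
  have ht0 : 0 ≤ t := nonneg_of_sn_nonneg (hsn ▸ hN0.le)
  refine ⟨h0, ?_, he1, he2⟩
  have : dist p (M.axis 0) = t := by
    rw [← h0]
    nth_rewrite 1 [ht]
    rw [M'.dist_axis, sub_zero, abs_of_nonneg ht0]
  rw [this, ← ht]

/-- If the cone of half-planes supporting `K` at a boundary point is symmetric with respect to the
normal of each supporting disc, then it consists of a single half-plane. -/
lemma slope_eq_zero (M : PlaneModel X k) {K : Set X} (hinter : (interior K).Nonempty) {R : ℝ}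
    (hR : 0 < R) (hK : K ⊆ closedBall (M.axis R) R)
    (hflip : ∀ M' : PlaneModel X k, M'.axis 0 = M.axis 0 → ∀ R > 0,
      K ⊆ closedBall (M'.axis R) R → ∀ s ≠ 0, K ⊆ M'.halfPlane (-1) s →
        K ⊆ M'.halfPlane (-1) (-s))
    {s : ℝ} (hs : K ⊆ M.halfPlane (-1) s) : s = 0 := by
  by_contra hs0
  set A := {s | K ⊆ M.halfPlane (-1) s} with hA
  have hflip' : ∀ s ∈ A, -s ∈ A := by
    intro s hs
    rcases eq_or_ne s 0 with rfl | h
    · simpa using hs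
    · exact hflip M rfl R hR hK s h hs
  obtain ⟨z₀, hz₀, hz₀2⟩ : ∃ z ∈ K, M.e₂ z ≠ 0 := by
    obtain ⟨z, hz⟩ := hinter
    by_cases h : M.e₂ z = 0
    · obtain ⟨t, ht, w, hw, -, hw2⟩ := M.exists_pos_mem_of_mem_interior hz 0 1
      exact ⟨w, hw, by rw [hw2, h]; linarith⟩
    · exact ⟨z, interior_subset hz, h⟩
  have habs : ∀ s ∈ A, ∀ z ∈ K, |s * M.e₂ z| ≤ M.e₁ z := by
    intro s hs z hz
    have h1 := hs hz
    have h2 := hflip' s hs hz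
    rw [mem_halfPlane] at h1 h2
    rw [abs_le]
    constructor <;> linarith
  have hbdd : BddAbove A := by
    refine ⟨M.e₁ z₀ / |M.e₂ z₀|, fun s hs => ?_⟩
    rw [le_div_iff₀ (abs_pos.2 hz₀2)]
    refine le_trans ?_ (habs s hs z₀ hz₀)
    rw [abs_mul]
    gcongr
    exact le_abs_self s
  have hclosed : IsClosed A := by
    have : A = ⋂ z ∈ K, {s : ℝ | -1 * M.e₁ z + s * M.e₂ z ≤ 0} := by
      ext s
      simp only [hA, mem_ofPred_eq, mem_iInter]
      rfl
    rw [this]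
    exact isClosed_biInter fun z _ => isClosed_le (by fun_prop) continuous_const
  have hmA : sSup A ∈ A := hclosed.csSup_mem ⟨s, hs⟩ hbdd
  have hle : ∀ s ∈ A, s ≤ sSup A := fun s hs => le_csSup hbdd hs
  set m := sSup A
  have hm : 0 < m := by
    rcases lt_or_gt_of_ne hs0 with h | h
    · linarith [hle _ (hflip' s hs)]
    · linarith [hle _ hs]
  set P := sn k R
  set W := cs k R
  have hP : 0 < P := sn_pos k hR
  have hW : 0 < W := cs_pos k R
  have hWP : W ^ 2 = 1 + k * P ^ 2 := cs_sq M.hk R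
  obtain ⟨a, ha, ha1, haP, haW⟩ : ∃ a > 0, a ≤ 1 ∧ a * (4 * (1 + m ^ 2)) ≤ P ∧
      a * (2 * P + 2 + m ^ 2) ≤ 1 := by
    refine ⟨min 1 (min (P / (4 * (1 + m ^ 2))) (1 / (2 * P + 2 + m ^ 2))), by positivity,
      min_le_left _ _, ?_, ?_⟩
    · rw [← le_div_iff₀ (by positivity)]
      exact (min_le_right _ _).trans (min_le_left _ _)
    · rw [← le_div_iff₀ (by positivity)]
      exact (min_le_right _ _).trans (min_le_right _ _)
  obtain ⟨p, c, hc, hp1, hp2, hp3⟩ := M.exists_normalized (u := P + a) (v := -(a * m)) hW (by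
    rw [hWP]
    have : 2 * a * P + a ^ 2 * (1 + m ^ 2) < 1 := by
      nlinarith [mul_nonneg ha.le (sub_nonneg.2 ha1), sq_nonneg m]
    rcases M.hk with hk | hk <;> rw [hk] <;> nlinarith)
  have hpK : K ⊆ closedBall p (dist p (M.axis 0)) := by
    intro z hz
    have h1 := hK hz
    have h2 : M.e₁ z - m * M.e₂ z ≥ 0 := by linarith [(abs_le.1 (habs m hmA z hz)).2]
    rw [mem_closedBall, M.sub_nonneg_iff_dist_axis_le hR.le] at h1
    rw [mem_closedBall, dist_comm p, M.dist_le_dist_axis_zero_iff]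
    refine le_of_mul_le_mul_left ?_ hc
    have e1 : c * (chord k (dist z (M.axis 0)) * M.e₃ p) = chord k (dist z (M.axis 0)) * W := by
      rw [hp3]; ring
    have e2 : c * (2 * (M.e₁ z * M.e₁ p + M.e₂ z * M.e₂ p)) =
        2 * M.e₁ z * P + 2 * a * (M.e₁ z - m * M.e₂ z) := by
      linear_combination -2 * M.e₁ z * hp1 - 2 * M.e₂ z * hp2
    rw [e1, e2]
    linarith [mul_nonneg (mul_nonneg zero_le_two ha.le) h2]
  have hp1' : 0 < M.e₁ p := pos_of_mul_pos_right (hp1 ▸ add_pos hP ha) hc.le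
  have hp2' : M.e₂ p < 0 := by
    by_contra! h
    linarith [mul_nonneg hc.le h, mul_pos ha hm]
  obtain ⟨g, hg, M', h0, hp, he1, he2⟩ := M.exists_rotate (p := p) (by positivity)
  have hpx : 0 < dist p (M.axis 0) := by
    rw [dist_pos, Ne, M.axis_zero_eq_iff]
    exact fun h => hp1'.ne' h.1
  have hD : 0 < M.e₁ p ^ 2 + 2 * m * M.e₁ p * M.e₂ p - M.e₂ p ^ 2 := by
    have h1 : 0 < (P + a) ^ 2 + 2 * m * (P + a) * -(a * m) - (-(a * m)) ^ 2 := by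
      nlinarith [mul_pos hP ha, sq_nonneg (a * m), mul_nonneg (sub_nonneg.2 haP) hP.le,
        mul_nonneg (sub_nonneg.2 haP) ha.le, mul_pos hP hP]
    rw [hp1, hp2] at h1
    have h2 : 0 < c ^ 2 * (M.e₁ p ^ 2 + 2 * m * M.e₁ p * M.e₂ p - M.e₂ p ^ 2) := by linarith
    exact pos_of_mul_pos_right h2 (sq_nonneg c)
  have hα : 0 < M.e₁ p + m * M.e₂ p := by
    by_contra! h
    nlinarith [mul_neg_of_pos_of_neg hm hp2', sq_nonneg (M.e₂ p)]
  have hβ : 0 < m * M.e₁ p - M.e₂ p := by linarith [mul_pos hm hp1']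
  set u := M.e₁ p
  set v := M.e₂ p
  have hK' := hflip M' h0 _ hpx (by rwa [hp]) (-((m * u - v) / (u + m * v)))
    (neg_ne_zero.2 (div_pos hβ hα).ne') (by
      intro z hz
      have h1 := hflip' m hmA hz
      rw [mem_halfPlane] at h1 ⊢
      have e : (u + m * v) * (-1 * M'.e₁ z + -((m * u - v) / (u + m * v)) * M'.e₂ z) =
          g * (u ^ 2 + v ^ 2) * (-1 * M.e₁ z + -m * M.e₂ z) := by
        rw [he1, he2]
        field_simp
        ring
      refine nonpos_of_mul_nonpos_right (e.trans_le ?_) hα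
      exact mul_nonpos_of_nonneg_of_nonpos (by positivity) h1)
  obtain ⟨D, hDe⟩ : ∃ D, D = u ^ 2 + 2 * m * u * v - v ^ 2 := ⟨_, rfl⟩
  rw [← hDe] at hD
  have hbig : (m * u ^ 2 - m * v ^ 2 - 2 * u * v) / D ∈ A := by
    intro z hz
    have h1 := hK' hz
    rw [mem_halfPlane, neg_neg] at h1
    rw [mem_halfPlane]
    have e : g * (D * (-1 * M.e₁ z + (m * u ^ 2 - m * v ^ 2 - 2 * u * v) / D * M.e₂ z)) =
        (u + m * v) * (-1 * M'.e₁ z + (m * u - v) / (u + m * v) * M'.e₂ z) := by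
      rw [he1, he2]
      field_simp
      rw [hDe]
      ring
    refine nonpos_of_mul_nonpos_right (nonpos_of_mul_nonpos_right (e.trans_le ?_) hg) hD
    exact mul_nonpos_of_nonneg_of_nonpos hα.le h1
  have := hle _ hbig
  rw [div_le_iff₀ hD, hDe] at this
  have huv := mul_neg_of_pos_of_neg hp1' hp2'
  nlinarith [mul_neg_of_neg_of_pos huv (pow_pos hm 2)]

end PlaneModel

lemma PlaneModel.smoothBody {k : ℝ} (M : PlaneModel X k) {K L : Set X} (h6 : T8Cond6 K L)
    (hKcl : IsClosed K) (hLcl : IsClosed L) (hKint : (interior K).Nonempty)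
    (hLint : (interior L).Nonempty) (hLpr : L ≠ univ) (hKsupp : SupportingSpheres 2 K)
    (hLsupp : SupportingSpheres 2 L) : SmoothBody K := by
  obtain ⟨y, hy, c, hyc, hc, q, hyq, hL⟩ : ∃ y ∈ frontier L, ∃ c, 0 < dist y c ∧
      closedBall c (dist y c) ⊆ L ∧ ∃ q, 0 < dist y q ∧ L ⊆ closedBall q (dist y q) := by
    have : PreconnectedSpace X :=
      ⟨by simpa using M.isPreconnected_compl_of_subsingleton subsingleton_empty⟩
    obtain ⟨y₀, hy₀⟩ := nonempty_frontier_iff.2 ⟨hLint.mono interior_subset, hLpr⟩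
    obtain ⟨p, R, -, hb, -⟩ := hLsupp y₀ hy₀
    obtain ⟨y, hy, c, hyc, hc⟩ := M.exists_inner_closedBall hLcl hLint hLpr hb
    obtain ⟨q, S, hS, hLq, hyS, -⟩ := hLsupp y hy
    rw [mem_sphere] at hyS
    exact ⟨y, hy, c, hyc, hc, q, hyS ▸ hS, hyS ▸ hLq⟩
  intro x hx
  obtain ⟨p, R, hR, hKp, hxR, -⟩ := hKsupp x hx
  obtain ⟨M, h0, h1⟩ := M.exists_frame x p
  rw [mem_sphere.1 hxR] at h1
  have hKR : K ⊆ closedBall (M.axis R) R := by rwa [h1]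
  have hxK : x ∈ K := hKcl.frontier_subset hx
  have hK0 : K ⊆ M.halfPlane (-1) 0 := hKR.trans (M.closedBall_axis_subset hR)
  have hslope : ∀ s, K ⊆ M.halfPlane (-1) s → s = 0 := by
    refine fun s => M.slope_eq_zero hKint hR hKR (fun M' h0' R hR hKR s hs hKs => ?_)
    rw [h0] at h0'
    exact M'.halfPlane_flip h6 (h0'.symm ▸ hx) (h0'.symm ▸ hxK) hR hKR hy
      (hLcl.frontier_subset hy) hyc hc hyq hL hs hKs
  refine ⟨M.halfPlane (-1) 0, ⟨M.isHalfspace_halfPlane (by simp), hK0, ?_⟩, ?_⟩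
  · rw [← h0, M.mem_frontier_halfPlane (by simp)]
    simp [sn_zero]
  · rintro P ⟨hP, hKP, hxP⟩
    rw [← h0] at hxP
    obtain ⟨α, β, hne, rfl⟩ := M.halfspace_eq_halfPlane hP hxP
    have hn : 0 < |α| + 1 - α := by linarith [le_abs_self α]
    have hβ : β = 0 := by
      have := hslope (β / (|α| + 1 - α)) (fun z hz => by
        have h1 := hKP hz
        have h2 := hK0 hz
        rw [PlaneModel.mem_halfPlane] at h1 h2 ⊢
        refine nonpos_of_mul_nonpos_right (a := |α| + 1 - α) ?_ hn
        have e : (|α| + 1 - α) * (-1 * M.e₁ z + β / (|α| + 1 - α) * M.e₂ z) =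
            α * M.e₁ z + β * M.e₂ z + (|α| + 1) * (-1 * M.e₁ z + 0 * M.e₂ z) := by
          field_simp
          ring
        rw [e]
        linarith [mul_nonpos_of_nonneg_of_nonpos (by positivity : 0 ≤ |α| + 1) h2])
      exact (div_eq_zero_iff.1 this).resolve_right hn.ne'
    subst hβ
    have hα : α < 0 := by
      by_contra! hα
      have hα' : 0 < α := lt_of_le_of_ne hα (Ne.symm (by simpa using hne))
      obtain ⟨z, hz⟩ := hKint
      obtain ⟨t, ht, w, hw, hw1, -⟩ := M.exists_pos_mem_of_mem_interior hz 1 0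
      have h1 := hKP hw
      have h2 := hK0 (interior_subset hz)
      rw [PlaneModel.mem_halfPlane] at h1 h2
      rw [hw1] at h1
      nlinarith [mul_pos hα' ht]
    ext z
    rw [← M.mem_of_mem_halfPlane_mul (neg_pos.2 hα) (α := -1) (β := 0)]
    simp

lemma T8Cond6.symm {K L : Set X} (h : T8Cond6 K L) : T8Cond6 L K := by
  have hu : ∀ φ ψ : X ≃ᵢ X, hullUnion L K φ ψ = hullUnion K L ψ φ := fun φ ψ => by
    rw [hullUnion, hullUnion, union_comm]
  obtain ⟨δ, hδ, h⟩ := h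
  refine ⟨δ, hδ, fun φ ψ hg x hx y hy hb hd => ?_⟩
  rw [hu] at hb hd
  obtain ⟨ε₀, hε₀, h⟩ := h ψ φ ⟨hg.2.1, hg.1, by rw [union_comm]; exact hg.2.2⟩ y hy x hx hb
    ⟨hd.2.1, hd.1, hd.2.2.1.symm, by rw [dist_comm]; exact hd.2.2.2.1,
      fun a ha b hb hab => (hd.2.2.2.2 a ha b hb hab).symm⟩
  refine ⟨ε₀, hε₀, fun ε hε hεε => ?_⟩
  rw [hu, segCyl_comm, union_comm]
  exact h ε hε hεε

/-- **Lemma 8.2.** Under hypothesis (****) with `d = 2` and `X = ℝ²` or `X = H²`, if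
both `K` and `L` have supporting circles at all of their boundary points, then
condition (6) of Theorem 8 (every sufficiently large hull of congruent copies with
unique diametral segment `D = [φx, ψy]`, intersected with `D(ε)` for all small
`ε > 0`, admits some non-trivial congruence) implies that `K` and `L` are `C¹`
(smooth). -/
theorem lemma8_2
    (X : Type*) [MetricSpace X]
    (hX : IsEuclideanSpaceForm X 2 ∨ IsHyperbolicSpace X 2)
    (K L : Set X)
    (hKcl : IsClosed K) (hLcl : IsClosed L)
    (hKcv : GConvex K) (hLcv : GConvex L)
    (hKint : (interior K).Nonempty) (hLint : (interior L).Nonempty)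
    (hKpr : K ≠ univ) (hLpr : L ≠ univ)
    (hKsupp : SupportingSpheres 2 K) (hLsupp : SupportingSpheres 2 L)
    (h6 : T8Cond6 K L) :
    SmoothBody K ∧ SmoothBody L := by
  have key : ∀ k : ℝ, Nonempty (PlaneModel X k) → SmoothBody K ∧ SmoothBody L := by
    rintro k ⟨M⟩
    exact ⟨M.smoothBody h6 hKcl hLcl hKint hLint hLpr hKsupp hLsupp,
      M.smoothBody h6.symm hLcl hKcl hLint hKint hKpr hLsupp hKsupp⟩
  rcases hX with hX | hX
  · exact key 0 hX.nonempty_planeModel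
  · exact key 1 hX.nonempty_planeModel

end BallChar
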